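/- arXiv:2511.04863 — 3 statements merged into one kernel-verified Lean document; each statement's English description precedes it below -/
import Mathlib

section
/- Let G be an r-uniform hypergraph with maximum degree Δ, and let 𝓔 = {E_1, …, E_n} be a partition of its edge set. If |E_i| ≥ rΔ + 1 for all i, then the reconfiguration graph RG(M(G), 𝓔) on full rainbow matchings is connected. -/
/-- `M` is a matching of the hypergraph with edge set `E`: a set of pairwise disjoint
edges. -/
def HypMatching {V : Type*} [DecidableEq V] (E : Finset (Finset V))
    (M : Finset (Finset V)) : Prop :=
  M ⊆ E ∧ ∀ e ∈ M, ∀ f ∈ M, e ≠ f → Disjoint e f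

/-- `M` is a full rainbow matching with respect to the edge partition
`Ep : Fin n → Finset (Finset V)`: a matching containing exactly one edge from each
class. -/
def IsFullRainbowMatching {V : Type*} [DecidableEq V] (E : Finset (Finset V)) {n : ℕ}
    (Ep : Fin n → Finset (Finset V)) (M : Finset (Finset V)) : Prop :=
  HypMatching E M ∧ ∀ i, (M ∩ Ep i).card = 1

/-- Adjacency in the reconfiguration graph `RG(𝓜(G), 𝓔)`: two full rainbow matchings
are adjacent if their union is a matching with `n + 1` edges. -/
def FRMAdj {V : Type*} [DecidableEq V] (E : Finset (Finset V)) {n : ℕ}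
    (Ep : Fin n → Finset (Finset V)) (M M' : Finset (Finset V)) : Prop :=
  IsFullRainbowMatching E Ep M ∧ IsFullRainbowMatching E Ep M' ∧
    HypMatching E (M ∪ M') ∧ (M ∪ M').card = n + 1


set_option linter.unusedSectionVars false

section Fermion
variable {B : Type*} [LinearOrder B] [Fintype B]

/-- The sign of inserting `a` into the ordered set `σ`. -/
noncomputable def sg (a : B) (σ : Finset B) : ℝ := (-1) ^ (σ.filter (· < a)).card

/-- Annihilation operator. -/
noncomputable def an (a : B) (φ : Finset B → ℝ) : Finset B → ℝ :=
  fun σ => if a ∈ σ then 0 else sg a σ * φ (insert a σ)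

/-- Creation operator. -/
noncomputable def cr (a : B) (φ : Finset B → ℝ) : Finset B → ℝ :=
  fun σ => if a ∈ σ then sg a σ * φ (σ.erase a) else 0

/-- Boundary in the directions `S`. -/
noncomputable def bdS (S : Finset B) (φ : Finset B → ℝ) : Finset B → ℝ :=
  fun σ => ∑ a ∈ S, an a φ σ

/-- Coboundary in the directions `S`. -/
noncomputable def cbS (S : Finset B) (φ : Finset B → ℝ) : Finset B → ℝ :=
  fun σ => ∑ a ∈ S, cr a φ σ

theorem sg_insert_lt {a b : B} {σ : Finset B} (hb : b ∉ σ) (h : b < a) :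
    sg a (insert b σ) = - sg a σ := by
  unfold sg
  rw [Finset.filter_insert, if_pos h, Finset.card_insert_of_notMem (by simp [hb]), pow_succ]
  ring

theorem sg_insert_not_lt {a b : B} {σ : Finset B} (h : ¬ b < a) :
    sg a (insert b σ) = sg a σ := by
  unfold sg
  rw [Finset.filter_insert, if_neg h]

theorem sg_sq (a : B) (σ : Finset B) : sg a σ * sg a σ = 1 := by
  unfold sg
  rw [← pow_add, ← two_mul, pow_mul]; norm_num

theorem an_an (a b : B) (φ : Finset B → ℝ) (σ : Finset B) :
    an a (an b φ) σ + an b (an a φ) σ = 0 := by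
  unfold an
  by_cases hab : a = b
  · subst hab; simp
  by_cases ha : a ∈ σ
  · simp [ha]
  by_cases hb : b ∈ σ
  · simp [hb]
  have hba : b ≠ a := fun h => hab h.symm
  simp only [ha, hb, hab, hba, Finset.mem_insert, if_false, or_self]
  rw [Finset.insert_comm b a]
  rcases lt_or_gt_of_ne hab with h | h
  · rw [sg_insert_lt ha h, sg_insert_not_lt (not_lt.2 h.le)]; ring
  · rw [sg_insert_lt hb h, sg_insert_not_lt (not_lt.2 h.le)]; ring

theorem an_cr (a b : B) (φ : Finset B → ℝ) (σ : Finset B) :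
    an a (cr b φ) σ + cr b (an a φ) σ = if a = b then φ σ else 0 := by
  unfold an cr
  by_cases hab : a = b
  · subst hab
    by_cases ha : a ∈ σ
    · obtain ⟨ρ, hρ, rfl⟩ : ∃ ρ, a ∉ ρ ∧ insert a ρ = σ :=
        ⟨σ.erase a, by simp, Finset.insert_erase ha⟩
      simp [hρ, sg_insert_not_lt, ← mul_assoc, sg_sq]
    · simp [ha, sg_insert_not_lt, ← mul_assoc, sg_sq]
  have hba : b ≠ a := fun h => hab h.symm
  by_cases ha : a ∈ σ
  · simp [ha, hab]
  by_cases hb : b ∈ σ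
  · obtain ⟨ρ, hρ, rfl⟩ : ∃ ρ, b ∉ ρ ∧ insert b ρ = σ :=
        ⟨σ.erase b, by simp, Finset.insert_erase hb⟩
    have haρ : a ∉ ρ := fun h => ha (Finset.mem_insert_of_mem h)
    have e1 : (insert a (insert b ρ)).erase b = insert a ρ := by
      ext x; simp; grind
    have e2 : (insert b ρ).erase b = ρ := Finset.erase_insert hρ
    simp only [ha, hab, Finset.mem_insert, hba, haρ, e1, e2, if_false, if_true,
      true_or, or_true]
    rw [Finset.insert_comm a b, sg_insert_not_lt (lt_irrefl b), sg_insert_not_lt (lt_irrefl b)]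
    rcases lt_or_gt_of_ne hab with h | h
    · rw [sg_insert_lt haρ h, sg_insert_not_lt (not_lt.2 h.le)]; ring
    · rw [sg_insert_lt hρ h, sg_insert_not_lt (not_lt.2 h.le)]; ring
  · simp [hb, hba, hab]

theorem an_adj (a : B) (φ ψ : Finset B → ℝ) :
    ∑ σ, an a φ σ * ψ σ = ∑ σ, φ σ * cr a ψ σ := by
  unfold an cr
  simp only [ite_mul, mul_ite, zero_mul, mul_zero]
  rw [← Finset.sum_filter, Finset.sum_ite, Finset.sum_const_zero, zero_add]
  refine Finset.sum_nbij' (fun σ => insert a σ) (fun σ => σ.erase a) ?_ ?_ ?_ ?_ ?_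
  · intro σ hσ; simp
  · intro σ hσ; simp
  · intro σ hσ; simp at hσ; simp [hσ]
  · intro σ hσ; simp at hσ; simp [hσ]
  · intro σ hσ
    simp at hσ
    simp [hσ, sg_insert_not_lt]; ring

theorem bdS_adj (S : Finset B) (φ ψ : Finset B → ℝ) :
    ∑ σ, bdS S φ σ * ψ σ = ∑ σ, φ σ * cbS S ψ σ := by
  unfold bdS cbS
  simp only [Finset.sum_mul, Finset.mul_sum]
  rw [Finset.sum_comm, Finset.sum_comm (s := Finset.univ)]
  exact Finset.sum_congr rfl fun a _ => an_adj a φ ψ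

theorem an_sum (a : B) (S : Finset B) (F : B → Finset B → ℝ) (σ : Finset B) :
    an a (fun τ => ∑ b ∈ S, F b τ) σ = ∑ b ∈ S, an a (F b) σ := by
  unfold an
  split_ifs <;> simp [Finset.mul_sum]

theorem cr_sum (a : B) (S : Finset B) (F : B → Finset B → ℝ) (σ : Finset B) :
    cr a (fun τ => ∑ b ∈ S, F b τ) σ = ∑ b ∈ S, cr a (F b) σ := by
  unfold cr
  split_ifs <;> simp [Finset.mul_sum]

theorem bdS_bdS (S : Finset B) (φ : Finset B → ℝ) (σ : Finset B) : bdS S (bdS S φ) σ = 0 := by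
  have h : bdS S (bdS S φ) σ = ∑ a ∈ S, ∑ b ∈ S, an a (an b φ) σ := by
    unfold bdS
    exact Finset.sum_congr rfl fun a _ => an_sum a S (fun b => an b φ) σ
  have h2 : ∑ a ∈ S, ∑ b ∈ S, an a (an b φ) σ + ∑ a ∈ S, ∑ b ∈ S, an a (an b φ) σ = 0 := by
    nth_rewrite 2 [Finset.sum_comm]
    rw [← Finset.sum_add_distrib]
    refine Finset.sum_eq_zero fun a _ => ?_
    rw [← Finset.sum_add_distrib]
    exact Finset.sum_eq_zero fun b _ => an_an a b φ σ
  rw [h]; linarith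

theorem laplace (S : Finset B) (φ : Finset B → ℝ) :
    ∑ σ, bdS S φ σ ^ 2 + ∑ σ, cbS S φ σ ^ 2 = S.card * ∑ σ, φ σ ^ 2 := by
  have h1 : ∑ σ, bdS S φ σ ^ 2 = ∑ σ, φ σ * cbS S (bdS S φ) σ := by
    rw [← bdS_adj]; simp [sq]
  have h2 : ∑ σ, cbS S φ σ ^ 2 = ∑ σ, φ σ * bdS S (cbS S φ) σ := by
    simp only [sq, mul_comm (φ _)]; rw [bdS_adj]
  rw [h1, h2, ← Finset.sum_add_distrib, Finset.mul_sum]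
  refine Finset.sum_congr rfl fun σ _ => ?_
  rw [← mul_add]
  have h3 : cbS S (bdS S φ) σ = ∑ b ∈ S, ∑ a ∈ S, cr b (an a φ) σ := by
    unfold cbS bdS
    exact Finset.sum_congr rfl fun a _ => cr_sum a S (fun b => an b φ) σ
  have h4 : bdS S (cbS S φ) σ = ∑ b ∈ S, ∑ a ∈ S, an a (cr b φ) σ := by
    rw [Finset.sum_comm]
    unfold cbS bdS
    exact Finset.sum_congr rfl fun a _ => an_sum a S (fun b => cr b φ) σ
  have h5 : cbS S (bdS S φ) σ + bdS S (cbS S φ) σ = S.card * φ σ := by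
    rw [h3, h4, ← Finset.sum_add_distrib]
    have : ∀ b ∈ S, (∑ a ∈ S, cr b (an a φ) σ + ∑ a ∈ S, an a (cr b φ) σ) = φ σ := by
      intro b hb
      rw [← Finset.sum_add_distrib]
      have : ∀ a ∈ S, cr b (an a φ) σ + an a (cr b φ) σ = if a = b then φ σ else 0 := by
        intro a _; rw [add_comm]; exact an_cr a b φ σ
      rw [Finset.sum_congr rfl this]; simp [hb]
    rw [Finset.sum_congr rfl this]; simp
  rw [h5]; ring

theorem exists_proj {X : Type*} [Fintype X] (K : Submodule ℝ (X → ℝ)) (z : X → ℝ) :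
    ∃ y ∈ K, ∀ k ∈ K, ∑ x, k x * (z x - y x) = 0 := by
  let K' : Submodule ℝ (EuclideanSpace ℝ X) := K.comap (WithLp.linearEquiv 2 ℝ (X → ℝ)).toLinearMap
  obtain ⟨y, hy, w, hw, h⟩ := K'.exists_add_mem_mem_orthogonal (WithLp.toLp 2 z)
  refine ⟨WithLp.ofLp y, hy, fun k hk => ?_⟩
  have h1 := hw (WithLp.toLp 2 k) hk
  have h2 : ∀ x, z x - y x = w x := by
    intro x
    have := congrArg (fun v : EuclideanSpace ℝ X => v x) h
    simp at this
    linarith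
  simp only [h2]
  simpa [PiLp.inner_apply, mul_comm] using h1

end Fermion

section Core
variable {B : Type*} [LinearOrder B] [Fintype B] {V : Type*} [Fintype V] [DecidableEq V] {n : ℕ}

/-- Faces of the auxiliary complex: the elements of `A` in `σ` form a matching and
no element of `A` in `σ` has the colour of a dummy in `σ`. -/
def GoodF (A : Finset B) (e : B → Finset V) (col : B → Fin n) (σ : Finset B) : Prop :=
  (∀ u ∈ σ, ∀ v ∈ σ, u ≠ v → u ∈ A → v ∈ A → Disjoint (e u) (e v)) ∧
  (∀ u ∈ σ, ∀ v ∈ σ, u ∉ A → v ∈ A → col u ≠ col v)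

theorem GoodF.mono {A : Finset B} {e : B → Finset V} {col : B → Fin n} {σ τ : Finset B}
    (h : GoodF A e col τ) (hs : σ ⊆ τ) : GoodF A e col σ :=
  ⟨fun u hu v hv => h.1 u (hs hu) v (hs hv), fun u hu v hv => h.2 u (hs hu) v (hs hv)⟩

theorem exists_of_bdS_ne {S : Finset B} {φ : Finset B → ℝ} {σ : Finset B} (h : bdS S φ σ ≠ 0) :
    ∃ a ∈ S, a ∉ σ ∧ φ (insert a σ) ≠ 0 := by
  obtain ⟨a, ha, h'⟩ := Finset.exists_ne_zero_of_sum_ne_zero h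
  refine ⟨a, ha, ?_⟩
  unfold an at h'
  split_ifs at h' with h2
  · exact absurd rfl h'
  · exact ⟨h2, right_ne_zero_of_mul h'⟩

theorem exists_of_cbS_ne {S : Finset B} {φ : Finset B → ℝ} {σ : Finset B} (h : cbS S φ σ ≠ 0) :
    ∃ a ∈ S, a ∈ σ ∧ φ (σ.erase a) ≠ 0 := by
  obtain ⟨a, ha, h'⟩ := Finset.exists_ne_zero_of_sum_ne_zero h
  refine ⟨a, ha, ?_⟩
  unfold cr at h'
  split_ifs at h' with h2
  · exact ⟨h2, right_ne_zero_of_mul h'⟩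
  · exact absurd rfl h'

theorem harmonic_vanish (A : Finset B) (e : B → Finset V) (col : B → Fin n) (d : Fin n → B)
    (hd : ∀ b, b ∉ A → b = d (col b)) (hdA : ∀ i, d i ∉ A) (hdc : ∀ i, col (d i) = i)
    (r Δ : ℕ) (hr : ∀ a ∈ A, (e a).card ≤ r)
    (hΔ : ∀ x, (A.filter fun a => x ∈ e a).card ≤ Δ)
    (hs : ∀ i, r * Δ + 1 ≤ (A.filter fun a => col a = i).card)
    (J : Finset B) (i₀ : Fin n) (hJ : d i₀ ∉ J) (φ : Finset B → ℝ)
    (hφ : ∀ σ, φ σ ≠ 0 → GoodF A e col σ ∧ σ.card = n ∧ σ \ A = J)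
    (hb : ∀ σ, bdS A φ σ = 0)
    (hc : ∀ τ, GoodF A e col τ → τ.card = n + 1 → τ \ A = J → cbS A φ τ = 0) :
    ∀ σ, φ σ = 0 := by
  classical
  by_contra! hne
  obtain ⟨σ₀, hσ₀⟩ := hne
  obtain ⟨-, hn0, hJ0⟩ := hφ σ₀ hσ₀
  set S := A.filter (fun a => d (col a) ∉ J) with hS
  set I := Finset.univ.filter (fun i => d i ∉ J) with hI
  have hJA : ∀ b ∈ J, b ∉ A := by
    intro b hb; rw [← hJ0] at hb; exact (Finset.mem_sdiff.1 hb).2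
  have hdinj : Function.Injective d := fun i j h => by
    have := congrArg col h; rwa [hdc, hdc] at this
  -- sizes
  have hJcard : J.card + I.card = n := by
    have h1 : J = (Finset.univ.filter (fun i => ¬ d i ∉ J)).image d := by
      ext b
      simp only [Finset.mem_image, Finset.mem_filter, Finset.mem_univ, true_and, not_not]
      constructor
      · intro hb; have := hd b (hJA b hb); exact ⟨col b, this ▸ hb, this.symm⟩
      · rintro ⟨i, hi, rfl⟩; exact hi
    have h2 : J.card = (Finset.univ.filter (fun i => ¬ d i ∉ J)).card := by
      conv_lhs => rw [h1]
      exact Finset.card_image_of_injective _ hdinj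
    have h3 := Finset.card_filter_add_card_filter_not (s := (Finset.univ : Finset (Fin n)))
      (fun i => d i ∉ J)
    rw [Finset.card_univ, Fintype.card_fin] at h3
    rw [h2, hI]; omega
  have hIpos : 0 < I.card := Finset.card_pos.2 ⟨i₀, by simp [hI, hJ]⟩
  have hScard : I.card * (r * Δ + 1) ≤ S.card := by
    rw [Finset.card_eq_sum_card_fiberwise (f := col) (s := S) (t := I)
      (by intro a ha; simp [hS] at ha; simp [hI, ha.2])]
    rw [← smul_eq_mul]
    refine Finset.card_nsmul_le_sum _ _ _ fun i hi => (hs i).trans (Finset.card_le_card ?_)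
    intro a ha
    simp only [hI, hS, Finset.mem_filter, Finset.mem_univ, true_and] at hi ha ⊢
    exact ⟨⟨ha.1, by rw [ha.2]; exact hi⟩, ha.2⟩
  -- boundary
  have hbS : ∀ σ, bdS S φ σ = 0 := by
    intro σ
    rw [← hb σ]
    refine Finset.sum_subset (Finset.filter_subset _ _) fun a ha haS => ?_
    unfold an
    split_ifs with h
    · rfl
    · by_contra h2
      obtain ⟨hg, -, hj⟩ := hφ _ (right_ne_zero_of_mul h2)
      have h3 : d (col a) ∈ J := by
        by_contra h4; exact haS (Finset.mem_filter.2 ⟨ha, h4⟩)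
      rw [← hj] at h3
      exact hg.2 _ (Finset.mem_sdiff.1 h3).1 a (Finset.mem_insert_self _ _) (hdA _) ha (hdc _)
  have hN : (S.card : ℝ) * ∑ σ, φ σ ^ 2 = ∑ σ, cbS S φ σ ^ 2 := by
    rw [← laplace S φ]; simp [hbS]
  -- localised pieces
  let ψ : V → Finset B → ℝ := fun x σ => if ∃ a ∈ σ, a ∈ A ∧ x ∈ e a then φ σ else 0
  let Sx : V → Finset B := fun x => S.filter (fun a => x ∈ e a)
  have hSx : ∀ x, ((Sx x).card : ℝ) ≤ Δ := by
    intro x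
    exact_mod_cast (Finset.card_le_card
      (Finset.filter_subset_filter _ (Finset.filter_subset _ _))).trans (hΔ x)
  have hpt : ∀ τ, cbS S φ τ ^ 2 ≤ ∑ x, cbS (Sx x) (ψ x) τ ^ 2 := by
    intro τ
    by_cases h0 : cbS S φ τ = 0
    · rw [h0]; simp only [ne_eq, OfNat.ofNat_ne_zero, not_false_eq_true, zero_pow]; positivity
    obtain ⟨a, haS, haτ, ha⟩ := exists_of_cbS_ne h0
    obtain ⟨hg, hcard, hj⟩ := hφ _ ha
    have haA : a ∈ A := (Finset.mem_filter.1 haS).1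
    have haJ : d (col a) ∉ J := (Finset.mem_filter.1 haS).2
    have hτJ : τ \ A = J := by
      rw [← hj]; ext b; simp only [Finset.mem_sdiff, Finset.mem_erase]; grind
    have hτc : τ.card = n + 1 := by
      rw [Finset.card_erase_of_mem haτ] at hcard
      have := Finset.card_pos.2 ⟨a, haτ⟩
      omega
    have hng : ¬ GoodF A e col τ := by
      intro hgτ
      apply h0
      rw [← hc τ hgτ hτc hτJ]
      refine Finset.sum_subset (Finset.filter_subset _ _) fun b hb hbS => ?_
      unfold cr
      split_ifs with h
      · exfalso
        have h3 : d (col b) ∈ J := by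
          by_contra h4; exact hbS (Finset.mem_filter.2 ⟨hb, h4⟩)
        rw [← hτJ] at h3
        exact hgτ.2 _ (Finset.mem_sdiff.1 h3).1 b h (hdA _) hb (hdc _)
      · rfl
    have hex : ∃ x u v, u ∈ τ ∧ v ∈ τ ∧ u ≠ v ∧ u ∈ A ∧ v ∈ A ∧ x ∈ e u ∧ x ∈ e v := by
      by_contra hno
      apply hng
      constructor
      · intro u hu v hv huv huA hvA
        rw [Finset.disjoint_left]
        intro x hxu hxv
        exact hno ⟨x, u, v, hu, hv, huv, huA, hvA, hxu, hxv⟩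
      · intro u hu v hv huA hvA heq
        by_cases hva : v = a
        · subst hva
          apply haJ
          rw [← heq, ← hd u huA, ← hτJ]
          exact Finset.mem_sdiff.2 ⟨hu, huA⟩
        · have hua : u ≠ a := fun h => huA (h ▸ haA)
          exact hg.2 u (Finset.mem_erase.2 ⟨hua, hu⟩) v (Finset.mem_erase.2 ⟨hva, hv⟩) huA hvA heq
    obtain ⟨x, u, v, hu, hv, huv, huA, hvA, hxu, hxv⟩ := hex
    have heq : cbS S φ τ = cbS (Sx x) (ψ x) τ := by
      symm
      have h1 : cbS (Sx x) (ψ x) τ = ∑ b ∈ Sx x, cr b φ τ := by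
        refine Finset.sum_congr rfl fun b hb => ?_
        unfold cr
        split_ifs with h
        · have : ψ x (τ.erase b) = φ (τ.erase b) := by
            refine if_pos ?_
            by_cases hub : u = b
            · exact ⟨v, Finset.mem_erase.2 ⟨fun h => huv (hub.trans h.symm), hv⟩, hvA, hxv⟩
            · exact ⟨u, Finset.mem_erase.2 ⟨hub, hu⟩, huA, hxu⟩
          rw [this]
        · rfl
      rw [h1]
      refine Finset.sum_subset (Finset.filter_subset _ _) fun b hb hbS => ?_
      have hxb : x ∉ e b := fun h => hbS (Finset.mem_filter.2 ⟨hb, h⟩)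
      unfold cr
      split_ifs with h
      · by_contra h2
        obtain ⟨hg', -, -⟩ := hφ _ (right_ne_zero_of_mul h2)
        have hub : u ≠ b := fun h => hxb (h ▸ hxu)
        have hvb : v ≠ b := fun h => hxb (h ▸ hxv)
        exact Finset.disjoint_left.1 (hg'.1 u (Finset.mem_erase.2 ⟨hub, hu⟩) v
          (Finset.mem_erase.2 ⟨hvb, hv⟩) huv huA hvA) hxu hxv
      · rfl
    rw [heq]
    exact Finset.single_le_sum (f := fun x => cbS (Sx x) (ψ x) τ ^ 2)
      (fun _ _ => sq_nonneg _) (Finset.mem_univ x)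
  have hx : ∀ x, ∑ τ, cbS (Sx x) (ψ x) τ ^ 2 ≤ Δ * ∑ σ, ψ x σ ^ 2 := by
    intro x
    have h1 := laplace (Sx x) (ψ x)
    have h2 : 0 ≤ ∑ σ, bdS (Sx x) (ψ x) σ ^ 2 := Finset.sum_nonneg fun _ _ => sq_nonneg _
    have h3 : ((Sx x).card : ℝ) * ∑ σ, ψ x σ ^ 2 ≤ Δ * ∑ σ, ψ x σ ^ 2 :=
      mul_le_mul_of_nonneg_right (hSx x) (Finset.sum_nonneg fun _ _ => sq_nonneg _)
    linarith
  have hψ : ∑ x, ∑ σ, ψ x σ ^ 2 ≤ (I.card * r : ℕ) * ∑ σ, φ σ ^ 2 := by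
    rw [Finset.sum_comm, Finset.mul_sum]
    refine Finset.sum_le_sum fun σ _ => ?_
    by_cases h0 : φ σ = 0
    · simp [ψ, h0]
    obtain ⟨hg, hcard, hj⟩ := hφ σ h0
    have h1 : ∑ x, ψ x σ ^ 2 =
        ((Finset.univ.filter fun x => ∃ a ∈ σ, a ∈ A ∧ x ∈ e a).card : ℝ) * φ σ ^ 2 := by
      simp only [ψ, ite_pow, ne_eq, OfNat.ofNat_ne_zero, not_false_eq_true, zero_pow]
      rw [← Finset.sum_filter]; simp
    rw [h1]
    refine mul_le_mul_of_nonneg_right ?_ (sq_nonneg _)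
    norm_cast
    have h2 : (Finset.univ.filter fun x => ∃ a ∈ σ, a ∈ A ∧ x ∈ e a) ⊆ (σ ∩ A).biUnion e := by
      intro x hx
      simp only [Finset.mem_filter, Finset.mem_univ, true_and] at hx
      obtain ⟨a, h1, h2, h3⟩ := hx
      exact Finset.mem_biUnion.2 ⟨a, Finset.mem_inter.2 ⟨h1, h2⟩, h3⟩
    refine (Finset.card_le_card h2).trans ?_
    have h3 : (σ ∩ A).card = I.card := by
      have := Finset.card_sdiff_add_card_inter σ A
      rw [hj] at this; omega
    rw [← h3]
    exact Finset.card_biUnion_le_card_mul _ _ _ fun a ha => hr a (Finset.mem_inter.1 ha).2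
  have hpos : 0 < ∑ σ, φ σ ^ 2 :=
    Finset.sum_pos' (fun _ _ => sq_nonneg _) ⟨σ₀, Finset.mem_univ _, by positivity⟩
  have hfin : (S.card : ℝ) * ∑ σ, φ σ ^ 2 ≤ Δ * ((I.card * r : ℕ) * ∑ σ, φ σ ^ 2) := by
    rw [hN]
    calc _ ≤ ∑ τ, ∑ x, cbS (Sx x) (ψ x) τ ^ 2 := Finset.sum_le_sum fun τ _ => hpt τ
      _ = ∑ x, ∑ τ, cbS (Sx x) (ψ x) τ ^ 2 := Finset.sum_comm
      _ ≤ ∑ x, Δ * ∑ σ, ψ x σ ^ 2 := Finset.sum_le_sum fun x _ => hx x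
      _ = Δ * ∑ x, ∑ σ, ψ x σ ^ 2 := by rw [Finset.mul_sum]
      _ ≤ _ := mul_le_mul_of_nonneg_left hψ (by positivity)
  rw [← mul_assoc] at hfin
  have h5 := le_of_mul_le_mul_right hfin hpos
  have h6 : S.card ≤ Δ * (I.card * r) := by exact_mod_cast h5
  nlinarith

/-- Linear version of `bdS`. -/
noncomputable def bdL (S : Finset B) : (Finset B → ℝ) →ₗ[ℝ] (Finset B → ℝ) where
  toFun := bdS S
  map_add' φ ψ := by
    ext σ
    simp only [bdS, Pi.add_apply, ← Finset.sum_add_distrib]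
    refine Finset.sum_congr rfl fun a _ => ?_
    unfold an; split_ifs <;> simp [mul_add]
  map_smul' t φ := by
    ext σ
    simp only [bdS, Pi.smul_apply, smul_eq_mul, RingHom.id_apply, Finset.mul_sum]
    refine Finset.sum_congr rfl fun a _ => ?_
    unfold an; split_ifs <;> simp [mul_left_comm]

theorem filling (A : Finset B) (e : B → Finset V) (col : B → Fin n) (d : Fin n → B)
    (hd : ∀ b, b ∉ A → b = d (col b)) (hdA : ∀ i, d i ∉ A) (hdc : ∀ i, col (d i) = i)
    (r Δ : ℕ) (hr : ∀ a ∈ A, (e a).card ≤ r)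
    (hΔ : ∀ x, (A.filter fun a => x ∈ e a).card ≤ Δ)
    (hs : ∀ i, r * Δ + 1 ≤ (A.filter fun a => col a = i).card)
    (J : Finset B) (i₀ : Fin n) (hJ : d i₀ ∉ J) (z : Finset B → ℝ)
    (hz : ∀ σ, z σ ≠ 0 → GoodF A e col σ ∧ σ.card = n ∧ σ \ A = J)
    (hb : ∀ σ, bdS A z σ = 0) :
    ∃ w : Finset B → ℝ, (∀ σ, w σ ≠ 0 → GoodF A e col σ ∧ σ.card = n + 1 ∧ σ \ A = J) ∧
      ∀ σ, bdS A w σ = z σ := by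
  classical
  let U : Submodule ℝ (Finset B → ℝ) :=
    { carrier := {w | ∀ σ, w σ ≠ 0 → GoodF A e col σ ∧ σ.card = n + 1 ∧ σ \ A = J}
      add_mem' := by
        intro w w' hw hw' σ h
        by_cases h1 : w σ = 0
        · exact hw' σ (by simpa [h1] using h)
        · exact hw σ h1
      zero_mem' := by intro σ h; simp at h
      smul_mem' := by
        intro t w hw σ h
        exact hw σ (right_ne_zero_of_mul (by simpa using h)) }
  obtain ⟨y, hy, hort⟩ := exists_proj (U.map (bdL A)) z
  obtain ⟨w, hw, rfl⟩ := Submodule.mem_map.1 hy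
  refine ⟨w, hw, ?_⟩
  have hsub : z - bdL A w = fun σ => z σ - bdS A w σ := rfl
  have key := harmonic_vanish A e col d hd hdA hdc r Δ hr hΔ hs J i₀ hJ (z - bdL A w) ?_ ?_ ?_
  · intro σ; have := key σ; rw [hsub] at this; simp only at this; linarith
  · intro σ hσ
    by_cases h1 : z σ = 0
    · have h2 : bdS A w σ ≠ 0 := by
        intro h; apply hσ; rw [hsub]; simp [h1, h]
      obtain ⟨a, ha, haσ, h3⟩ := exists_of_bdS_ne h2
      obtain ⟨hg, hc, hj⟩ := hw _ h3
      refine ⟨hg.mono (Finset.subset_insert _ _), ?_, ?_⟩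
      · rw [Finset.card_insert_of_notMem haσ] at hc; omega
      · rw [← hj, Finset.insert_sdiff_of_mem _ ha]
    · exact hz σ h1
  · intro σ
    have h1 : bdS A (z - bdL A w) σ = bdS A z σ - bdS A (bdS A w) σ :=
      congrFun (map_sub (bdL A) z (bdL A w)) σ
    rw [h1, hb, bdS_bdS, sub_zero]
  · intro τ hg hc hj
    have h1 := hort (bdL A (Pi.single τ 1)) (Submodule.mem_map_of_mem (by
      intro σ hσ
      by_cases h : σ = τ
      · subst h; exact ⟨hg, hc, hj⟩
      · simp [h] at hσ))
    have h2 := bdS_adj A (Pi.single τ 1) (z - bdL A w)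
    change ∑ σ, bdS A (Pi.single τ 1) σ * (z - bdL A w) σ = 0 at h1
    rw [h1] at h2
    simpa [Pi.single_apply] using h2.symm

theorem pairing_zero (A : Finset B) (e : B → Finset V) (col : B → Fin n) (d : Fin n → B)
    (hd : ∀ b, b ∉ A → b = d (col b)) (hdA : ∀ i, d i ∉ A) (hdc : ∀ i, col (d i) = i)
    (r Δ : ℕ) (hr : ∀ a ∈ A, (e a).card ≤ r)
    (hΔ : ∀ x, (A.filter fun a => x ∈ e a).card ≤ Δ)
    (hs : ∀ i, r * Δ + 1 ≤ (A.filter fun a => col a = i).card)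
    (φ : Finset B → ℝ)
    (hφ : ∀ τ, GoodF A e col τ → τ.card = n + 1 → cbS Finset.univ φ τ = 0)
    (N : ℕ) : ∀ (T : Finset (Finset B)), T.card = N →
      (∀ J ∈ T, ∀ J' ⊆ J, J' ∈ T) → (∀ J ∈ T, ∃ i, d i ∉ J) →
      ∀ Z : Finset B → ℝ,
        (∀ σ, Z σ ≠ 0 → GoodF A e col σ ∧ σ.card = n ∧ σ \ A ∈ T) →
        (∀ σ, bdS Finset.univ Z σ = 0) → ∑ σ, Z σ * φ σ = 0 := by
  classical
  induction N with
  | zero =>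
    intro T hT _ _ Z hZ _
    rw [Finset.card_eq_zero] at hT
    refine Finset.sum_eq_zero fun σ _ => ?_
    by_contra h
    have := (hZ σ (left_ne_zero_of_mul h)).2.2
    simp [hT] at this
  | succ N ih =>
    intro T hT hlow hprop Z hZ hbZ
    obtain ⟨J, hJT, hJmax⟩ := T.exists_max_image Finset.card (Finset.card_pos.1 (by omega))
    obtain ⟨i₀, hi₀⟩ := hprop J hJT
    -- inserting a dummy leaves `T`
    have hout : ∀ (F : Finset B → ℝ), (∀ σ, F σ ≠ 0 → σ \ A ∈ T) → ∀ σ, σ \ A = J →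
        bdS Finset.univ F σ = bdS A F σ := by
      intro F hF σ hσ
      symm
      refine Finset.sum_subset (Finset.subset_univ _) fun a _ ha => ?_
      unfold an
      split_ifs with h
      · rfl
      · by_contra h2
        have h3 := hJmax _ (hF _ (right_ne_zero_of_mul h2))
        rw [Finset.insert_sdiff_of_notMem _ ha, hσ, Finset.card_insert_of_notMem] at h3
        · omega
        · rw [← hσ]; simp [h]
    let z : Finset B → ℝ := fun σ => if σ \ A = J then Z σ else 0
    have hins : ∀ a ∈ A, ∀ σ : Finset B, insert a σ \ A = σ \ A := fun a ha σ =>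
      Finset.insert_sdiff_of_mem _ ha
    obtain ⟨w, hw, hwz⟩ := filling A e col d hd hdA hdc r Δ hr hΔ hs J i₀ hi₀ z (by
        intro σ hσ
        simp only [z] at hσ
        split_ifs at hσ with h
        · exact ⟨(hZ σ hσ).1, (hZ σ hσ).2.1, h⟩
        · exact absurd rfl hσ) (by
        intro σ
        by_cases h : σ \ A = J
        · rw [← hbZ σ, hout Z (fun σ hσ => (hZ σ hσ).2.2) σ h]
          refine Finset.sum_congr rfl fun a ha => ?_
          simp [an, z, hins a ha, h]
        · refine Finset.sum_eq_zero fun a ha => ?_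
          simp [an, z, hins a ha, h])
    have hwT : ∀ σ, w σ ≠ 0 → σ \ A ∈ T := fun σ hσ => by rw [(hw σ hσ).2.2]; exact hJT
    have hmain := ih (T.erase J) (by rw [Finset.card_erase_of_mem hJT]; omega) (by
        intro K hK K' hK'
        rw [Finset.mem_erase] at hK ⊢
        refine ⟨?_, hlow K hK.2 K' hK'⟩
        rintro rfl
        exact hK.1 (Finset.eq_of_subset_of_card_le hK' (hJmax K hK.2)).symm)
      (fun K hK => hprop K (Finset.mem_of_mem_erase hK))
      (Z - bdL Finset.univ w) (by
        intro σ hσ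
        have hval : (Z - bdL Finset.univ w) σ = Z σ - bdS Finset.univ w σ := rfl
        have hne : σ \ A ≠ J := by
          intro h
          apply hσ
          rw [hval, hout w hwT σ h, hwz]
          simp [z, h]
        by_cases h1 : Z σ = 0
        · have h2 : bdS Finset.univ w σ ≠ 0 := by
            intro h; apply hσ; rw [hval, h1, h, sub_zero]
          obtain ⟨a, ha, haσ, h3⟩ := exists_of_bdS_ne h2
          obtain ⟨hg, hc, hj⟩ := hw _ h3
          refine ⟨hg.mono (Finset.subset_insert _ _), ?_, Finset.mem_erase.2 ⟨hne, ?_⟩⟩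
          · rw [Finset.card_insert_of_notMem haσ] at hc; omega
          · refine hlow J hJT _ ?_
            rw [← hj]; exact Finset.sdiff_subset_sdiff (Finset.subset_insert _ _) le_rfl
        · obtain ⟨hg, hc, hj⟩ := hZ σ h1
          exact ⟨hg, hc, Finset.mem_erase.2 ⟨hne, hj⟩⟩) (by
        intro σ
        have h1 : bdS Finset.univ (Z - bdL Finset.univ w) σ =
            bdS Finset.univ Z σ - bdS Finset.univ (bdS Finset.univ w) σ :=
          congrFun (map_sub (bdL Finset.univ) Z (bdL Finset.univ w)) σ
        rw [h1, hbZ, bdS_bdS, sub_zero])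
    have h3 : ∑ σ, bdS Finset.univ w σ * φ σ = 0 := by
      rw [bdS_adj]
      refine Finset.sum_eq_zero fun σ _ => ?_
      by_cases h : w σ = 0
      · rw [h, zero_mul]
      · rw [hφ σ (hw σ h).1 (hw σ h).2.1, mul_zero]
    have h4 : ∑ σ, (Z - bdL Finset.univ w) σ * φ σ =
        ∑ σ, Z σ * φ σ - ∑ σ, bdS Finset.univ w σ * φ σ := by
      rw [← Finset.sum_sub_distrib]
      exact Finset.sum_congr rfl fun σ _ => sub_mul _ _ _
    rw [h4, h3, sub_zero] at hmain
    exact hmain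

end Core

section Final
variable {B : Type*} [LinearOrder B] [Fintype B] {V : Type*} [Fintype V] [DecidableEq V] {n : ℕ}

/-- Full rainbow faces consisting of edges. -/
def RbF (A : Finset B) (e : B → Finset V) (col : B → Fin n) (σ : Finset B) : Prop :=
  σ ⊆ A ∧ GoodF A e col σ ∧ σ.card = n ∧ Set.InjOn col σ

theorem RbF.exists_col {A : Finset B} {e : B → Finset V} {col : B → Fin n} {σ : Finset B}
    (h : RbF A e col σ) (i : Fin n) : ∃ m ∈ σ, col m = i := by
  have h1 : σ.image col = Finset.univ := by
    apply Finset.eq_univ_of_card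
    rw [Finset.card_image_of_injOn h.2.2.2, h.2.2.1, Fintype.card_fin]
  have h2 : i ∈ σ.image col := by rw [h1]; exact Finset.mem_univ _
  simpa using h2

/-- Condition for being a facet of the cross-polytope of `M`. -/
def CrossF (A : Finset B) (col : B → Fin n) (M σ : Finset B) : Prop :=
  (∀ a ∈ σ, a ∈ A → a ∈ M) ∧ Set.InjOn col σ ∧ σ.card = n

open Classical in
/-- The cross-polytope cycle of `M`. -/
noncomputable def crossZ (A : Finset B) (col : B → Fin n) (M : Finset B) : Finset B → ℝ :=
  fun σ => if CrossF A col M σ then (-1) ^ (σ \ A).card else 0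

theorem crossZ_ne {A : Finset B} {col : B → Fin n} {M σ : Finset B}
    (h : crossZ A col M σ ≠ 0) : CrossF A col M σ := by
  unfold crossZ at h
  split_ifs at h with h1
  · exact h1
  · exact absurd rfl h

theorem CrossF.good {A : Finset B} {e : B → Finset V} {col : B → Fin n} {M σ : Finset B}
    (hM : RbF A e col M) (h : CrossF A col M σ) : GoodF A e col σ := by
  constructor
  · intro u hu v hv huv huA hvA
    exact hM.2.1.1 u (h.1 u hu huA) v (h.1 v hv hvA) huv huA hvA
  · intro u hu v hv huA hvA heq
    exact huA (h.2.1 hu hv heq ▸ hvA)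

theorem crossZ_cycle (A : Finset B) (e : B → Finset V) (col : B → Fin n) (hcol : Monotone col)
    (d : Fin n → B)
    (hd : ∀ b, b ∉ A → b = d (col b)) (hdA : ∀ i, d i ∉ A) (hdc : ∀ i, col (d i) = i)
    (M : Finset B) (hM : RbF A e col M) (σ : Finset B) :
    bdS Finset.univ (crossZ A col M) σ = 0 := by
  by_contra h0
  obtain ⟨a, -, haσ, ha⟩ := exists_of_bdS_ne h0
  have hc := crossZ_ne ha
  have hcard : σ.card + 1 = n := by
    rw [← Finset.card_insert_of_notMem haσ]; exact hc.2.2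
  have hσinj : Set.InjOn col σ := hc.2.1.mono (by simp)
  have hmiss : ∀ c ∈ σ, col c ≠ col a := by
    intro c hcσ heq
    have := hc.2.1 (by simp [hcσ]) (by simp) heq
    exact haσ (this ▸ hcσ)
  obtain ⟨m, hmM, hm⟩ := hM.exists_col (col a)
  have hmA : m ∈ A := hM.1 hmM
  -- colours of `σ` are all but `col a`
  have hrest : ∀ c, c ∉ σ → CrossF A col M (insert c σ) → col c = col a := by
    intro c hcσ hcF
    by_contra hne
    have h1 : (insert (col a) (insert (col c) (σ.image col))).card = n + 1 := by
      rw [Finset.card_insert_of_notMem, Finset.card_insert_of_notMem,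
        Finset.card_image_of_injOn hσinj]
      · omega
      · simp only [Finset.mem_image, not_exists, not_and]
        intro x hx heq
        exact hcσ (hcF.2.1 (by simp [hx]) (by simp) heq ▸ hx)
      · simp only [Finset.mem_insert, Finset.mem_image, not_or, not_exists, not_and]
        exact ⟨fun h => hne h.symm, fun x hx => hmiss x hx⟩
    have h2 := Finset.card_le_univ (insert (col a) (insert (col c) (σ.image col)))
    rw [h1, Fintype.card_fin] at h2
    omega
  have hF : ∀ c, col c = col a → (c ∈ A → c ∈ M) → c ∉ σ ∧ CrossF A col M (insert c σ) := by
    intro c hca hcM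
    have hcσ : c ∉ σ := fun h => hmiss c h hca
    refine ⟨hcσ, ?_, ?_, ?_⟩
    · intro b hb hbA
      rcases Finset.mem_insert.1 hb with rfl | hb
      · exact hcM hbA
      · exact hc.1 b (Finset.mem_insert_of_mem hb) hbA
    · rw [Finset.coe_insert, Set.injOn_insert (by simpa using hcσ)]
      refine ⟨hσinj, ?_⟩
      rintro ⟨x, hx, heq⟩
      exact hmiss x hx (heq.trans hca)
    · rw [Finset.card_insert_of_notMem hcσ]; exact hcard
  have hsg : ∀ c, col c = col a → sg c σ = sg a σ := by
    intro c hca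
    have hlt : ∀ x ∈ σ, ∀ y, col y = col a → (x < y ↔ col x < col a) := by
      intro x hx y hy
      constructor
      · intro h; exact lt_of_le_of_ne (hy ▸ hcol h.le) (hmiss x hx)
      · intro h; by_contra h2
        exact absurd (hcol (not_lt.1 h2)) (by rw [hy]; exact not_le.2 h)
    unfold sg
    congr 2
    apply Finset.filter_congr
    intro x hx
    rw [hlt x hx c hca, hlt x hx a rfl]
  have hmd : m ≠ d (col a) := fun h => hdA _ (h ▸ hmA)
  have hsum : bdS Finset.univ (crossZ A col M) σ =
      an m (crossZ A col M) σ + an (d (col a)) (crossZ A col M) σ := by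
    unfold bdS
    refine Finset.sum_eq_add m (d (col a)) hmd ?_ ?_ ?_
    · rintro c - ⟨hcm, hcd⟩
      unfold an
      split_ifs with h
      · rfl
      · by_contra h2
        have hcF := crossZ_ne (right_ne_zero_of_mul h2)
        have hca := hrest c h hcF
        by_cases hcA : c ∈ A
        · have hcM := hcF.1 c (Finset.mem_insert_self _ _) hcA
          exact hcm (hM.2.2.2 hcM hmM (hca.trans hm.symm))
        · exact hcd (hca ▸ hd c hcA)
    · intro h; exact absurd (Finset.mem_univ _) h
    · intro h; exact absurd (Finset.mem_univ _) h
  apply h0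
  rw [hsum]
  obtain ⟨h1, h2⟩ := hF m hm (fun _ => hmM)
  obtain ⟨h3, h4⟩ := hF (d (col a)) (hdc _) (fun h => absurd h (hdA _))
  unfold an crossZ
  rw [if_neg h1, if_neg h3, if_pos h2, if_pos h4, hsg m hm, hsg (d (col a)) (hdc _),
    Finset.insert_sdiff_of_mem _ hmA, Finset.insert_sdiff_of_notMem _ (hdA _),
    Finset.card_insert_of_notMem (by simp [h3]), pow_succ]
  ring

theorem core_connect (A : Finset B) (e : B → Finset V) (col : B → Fin n) (hcol : Monotone col)
    (d : Fin n → B)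
    (hd : ∀ b, b ∉ A → b = d (col b)) (hdA : ∀ i, d i ∉ A) (hdc : ∀ i, col (d i) = i)
    (r Δ : ℕ) (hr : ∀ a ∈ A, (e a).card ≤ r)
    (hΔ : ∀ x, (A.filter fun a => x ∈ e a).card ≤ Δ)
    (hs : ∀ i, r * Δ + 1 ≤ (A.filter fun a => col a = i).card)
    (f : Finset B → ℝ)
    (hf : ∀ τ, τ ⊆ A → GoodF A e col τ → τ.card = n + 1 → ∀ a ∈ τ, ∀ b ∈ τ, a ≠ b →
      RbF A e col (τ.erase a) → RbF A e col (τ.erase b) → f (τ.erase a) = f (τ.erase b))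
    (M M' : Finset B) (hM : RbF A e col M) (hM' : RbF A e col M') : f M = f M' := by
  classical
  let φ : Finset B → ℝ := fun σ => if RbF A e col σ then f σ else 0
  have hpair : ∀ M, RbF A e col M → ∑ σ, crossZ A col M σ * φ σ = f M := by
    intro M hM
    rw [Finset.sum_eq_single M]
    · have h1 : CrossF A col M M := ⟨fun a h _ => h, hM.2.2.2, hM.2.2.1⟩
      have h2 : M \ A = ∅ := Finset.sdiff_eq_empty_iff_subset.2 hM.1
      simp [crossZ, φ, h1, hM, h2]
    · intro σ _ hne
      by_contra h
      have h1 := crossZ_ne (left_ne_zero_of_mul h)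
      have h2 : RbF A e col σ := by
        by_contra h3; exact right_ne_zero_of_mul h (if_neg h3)
      apply hne
      refine Finset.eq_of_subset_of_card_le (fun a ha => h1.1 a ha (h2.1 ha)) ?_
      rw [hM.2.2.1, h2.2.2.1]
    · intro h; exact absurd (Finset.mem_univ _) h
  have hcb : ∀ τ, GoodF A e col τ → τ.card = n + 1 → cbS Finset.univ φ τ = 0 := by
    intro τ hg hc
    have hpig : ∃ a ∈ τ, ∃ b ∈ τ, a < b ∧ col a = col b := by
      obtain ⟨a, ha, b, hb, hab, heq⟩ := Finset.exists_ne_map_eq_of_card_lt_of_maps_to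
        (s := τ) (t := (Finset.univ : Finset (Fin n))) (f := col)
        (by rw [Finset.card_univ, Fintype.card_fin]; omega) (by intro x _; simp)
      rcases lt_or_gt_of_ne hab with h | h
      · exact ⟨a, ha, b, hb, h, heq⟩
      · exact ⟨b, hb, a, ha, h, heq.symm⟩
    obtain ⟨a, ha, b, hb, hab, heq⟩ := hpig
    have habA : a ∈ A ∧ b ∈ A := by
      by_cases h1 : a ∈ A
      · by_cases h2 : b ∈ A
        · exact ⟨h1, h2⟩
        · exact absurd heq.symm (hg.2 b hb a ha h2 h1)
      · by_cases h2 : b ∈ A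
        · exact absurd heq (hg.2 a ha b hb h1 h2)
        · exact absurd ((hd a h1).trans ((congrArg d heq).trans (hd b h2).symm)) hab.ne
    have hsum : cbS Finset.univ φ τ = cr a φ τ + cr b φ τ := by
      unfold cbS
      refine Finset.sum_eq_add a b hab.ne ?_ ?_ ?_
      · rintro c - ⟨hca, hcb⟩
        unfold cr
        split_ifs with h
        · by_contra h2
          have h3 : RbF A e col (τ.erase c) := by
            by_contra h4; exact right_ne_zero_of_mul h2 (if_neg h4)
          exact hab.ne (h3.2.2.2 (by simp [ha, hca.symm]) (by simp [hb, hcb.symm]) heq)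
        · rfl
      · intro h; exact absurd (Finset.mem_univ _) h
      · intro h; exact absurd (Finset.mem_univ _) h
    have hswap : ∀ a b, a ∈ τ → b ∈ τ → a ≠ b → a ∈ A → col a = col b →
        RbF A e col (τ.erase a) → RbF A e col (τ.erase b) := by
      intro a b ha hb hab haA heq h
      have hτA : ∀ x ∈ τ, x ∈ A := by
        intro x hx
        by_cases hxa : x = a
        · exact hxa ▸ haA
        · exact h.1 (Finset.mem_erase.2 ⟨hxa, hx⟩)
      refine ⟨fun x hx => hτA x (Finset.mem_of_mem_erase hx), hg.mono (Finset.erase_subset _ _),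
        by rw [Finset.card_erase_of_mem hb]; omega, ?_⟩
      have hi : ∀ x ∈ τ, ∀ y ∈ τ, x ≠ a → y ≠ a → col x = col y → x = y :=
        fun x hx y hy hxa hya hxy => h.2.2.2 (by simp [hx, hxa]) (by simp [hy, hya]) hxy
      intro x hx y hy hxy
      simp only [Finset.coe_erase, Set.mem_sdiff, Finset.mem_coe, Set.mem_singleton_iff] at hx hy
      by_cases hxa : x = a
      · by_cases hya : y = a
        · rw [hxa, hya]
        · exact absurd (hi y hy.1 b hb hya hab.symm (by rw [← hxy, hxa, heq])) hy.2
      · by_cases hya : y = a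
        · exact absurd (hi x hx.1 b hb hxa hab.symm (by rw [hxy, hya, heq])) hx.2
        · exact hi x hx.1 y hy.1 hxa hya hxy
    rw [hsum]
    unfold cr
    rw [if_pos ha, if_pos hb]
    by_cases hRa : RbF A e col (τ.erase a)
    · have hRb := hswap a b ha hb hab.ne habA.1 heq hRa
      have hτA : τ ⊆ A := by
        intro x hx
        by_cases hxa : x = a
        · exact hxa ▸ habA.1
        · exact hRa.1 (Finset.mem_erase.2 ⟨hxa, hx⟩)
      have hff := hf τ hτA hg hc a ha b hb hab.ne hRa hRb
      have hsgn : sg b τ = - sg a τ := by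
        have h1 : τ.filter (· < b) = insert a (τ.filter (· < a)) := by
          ext x
          simp only [Finset.mem_filter, Finset.mem_insert]
          constructor
          · rintro ⟨hx, hxb⟩
            rcases lt_trichotomy x a with h | h | h
            · exact Or.inr ⟨hx, h⟩
            · exact Or.inl h
            · exfalso
              have hcx : col x = col b := le_antisymm (hcol hxb.le) (heq ▸ hcol h.le)
              exact hxb.ne (hRa.2.2.2 (by simp [hx, h.ne']) (by simp [hb, hab.ne']) hcx)
          · rintro (rfl | ⟨hx, h⟩)
            · exact ⟨ha, hab⟩
            · exact ⟨hx, h.trans hab⟩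
        unfold sg
        rw [h1, Finset.card_insert_of_notMem (by simp), pow_succ]; ring
      simp only [φ]
      rw [if_pos hRa, if_pos hRb, hff, hsgn]; ring
    · have hRb : ¬ RbF A e col (τ.erase b) := fun h =>
        hRa (hswap b a hb ha hab.ne' habA.2 heq.symm h)
      simp only [φ]
      rw [if_neg hRa, if_neg hRb]; ring
  have key := pairing_zero A e col d hd hdA hdc r Δ hr hΔ hs φ hcb _
    (Finset.univ.filter fun J => ∃ i, d i ∉ J) rfl (by
      intro J hJ J' hJ'
      simp only [Finset.mem_filter, Finset.mem_univ, true_and] at hJ ⊢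
      obtain ⟨i, hi⟩ := hJ
      exact ⟨i, fun h => hi (hJ' h)⟩) (by
      intro J hJ
      simpa using hJ)
    (crossZ A col M - crossZ A col M') (by
      intro σ hσ
      have hgc : GoodF A e col σ ∧ σ.card = n ∧ Set.InjOn col σ := by
        by_cases h1 : crossZ A col M σ = 0
        · have h2 : crossZ A col M' σ ≠ 0 := by
            intro h; apply hσ; simp [h1, h]
          exact ⟨(crossZ_ne h2).good hM', (crossZ_ne h2).2.2, (crossZ_ne h2).2.1⟩
        · exact ⟨(crossZ_ne h1).good hM, (crossZ_ne h1).2.2, (crossZ_ne h1).2.1⟩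
      refine ⟨hgc.1, hgc.2.1, ?_⟩
      simp only [Finset.mem_filter, Finset.mem_univ, true_and]
      by_contra! hall
      have hno : ∀ a ∈ σ, a ∉ A := by
        intro a ha haA
        have h1 := (Finset.mem_sdiff.1 (hall (col a))).1
        exact hdA _ ((hgc.2.2 h1 ha (hdc _)) ▸ haA)
      have hcross : ∀ M, CrossF A col M σ := fun M =>
        ⟨fun a ha haA => absurd haA (hno a ha), hgc.2.2, hgc.2.1⟩
      apply hσ
      simp [crossZ, hcross]) (by
      intro σ
      have h1 : bdS Finset.univ (crossZ A col M - crossZ A col M') σ =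
          bdS Finset.univ (crossZ A col M) σ - bdS Finset.univ (crossZ A col M') σ :=
        congrFun (map_sub (bdL Finset.univ) _ _) σ
      rw [h1, crossZ_cycle A e col hcol d hd hdA hdc M hM,
        crossZ_cycle A e col hcol d hd hdA hdc M' hM', sub_zero])
  have h4 : ∑ σ, (crossZ A col M - crossZ A col M') σ * φ σ =
      ∑ σ, crossZ A col M σ * φ σ - ∑ σ, crossZ A col M' σ * φ σ := by
    rw [← Finset.sum_sub_distrib]
    exact Finset.sum_congr rfl fun σ _ => sub_mul _ _ _
  rw [h4, hpair M hM, hpair M' hM'] at key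
  linarith

theorem rainbow_connect (E : Finset (Finset V)) (r Δ : ℕ)
    (huniform : ∀ e ∈ E, e.card = r)
    (hΔ : ∀ v : V, (E.filter fun e => v ∈ e).card ≤ Δ)
    (Ep : Fin n → Finset (Finset V))
    (hdisj : ∀ i j, i ≠ j → Disjoint (Ep i) (Ep j))
    (hcover : Finset.univ.biUnion Ep = E)
    (hsize : ∀ i, r * Δ + 1 ≤ (Ep i).card)
    (A : Finset B) (e : B → Finset V) (col : B → Fin n) (hcol : Monotone col)
    (d : Fin n → B)
    (hd : ∀ b, b ∉ A → b = d (col b)) (hdA : ∀ i, d i ∉ A) (hdc : ∀ i, col (d i) = i)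
    (he : ∀ b ∈ A, e b ∈ Ep (col b)) (hsurj : ∀ i, ∀ x ∈ Ep i, ∃ b ∈ A, col b = i ∧ e b = x)
    (hinj : Set.InjOn e A)
    (M M' : Finset (Finset V))
    (hM : IsFullRainbowMatching E Ep M) (hM' : IsFullRainbowMatching E Ep M') :
    Relation.ReflTransGen (FRMAdj E Ep) M M' := by
  classical
  have heE : ∀ b ∈ A, e b ∈ E := fun b hb => by
    rw [← hcover]; exact Finset.mem_biUnion.2 ⟨_, Finset.mem_univ _, he b hb⟩
  have hmatch : ∀ σ, σ ⊆ A → GoodF A e col σ → HypMatching E (σ.image e) := by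
    intro σ hσ hg
    constructor
    · intro x hx
      obtain ⟨b, hb, rfl⟩ := Finset.mem_image.1 hx
      exact heE b (hσ hb)
    · intro x hx y hy hxy
      obtain ⟨b, hb, rfl⟩ := Finset.mem_image.1 hx
      obtain ⟨c, hc, rfl⟩ := Finset.mem_image.1 hy
      exact hg.1 b hb c hc (fun h => hxy (h ▸ rfl)) (hσ hb) (hσ hc)
  have hfull : ∀ σ, RbF A e col σ → IsFullRainbowMatching E Ep (σ.image e) := by
    intro σ hσ
    refine ⟨hmatch σ hσ.1 hσ.2.1, fun i => ?_⟩
    obtain ⟨m, hm, hmi⟩ := hσ.exists_col i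
    rw [Finset.card_eq_one]
    refine ⟨e m, ?_⟩
    ext x
    simp only [Finset.mem_inter, Finset.mem_image, Finset.mem_singleton]
    constructor
    · rintro ⟨⟨b, hb, rfl⟩, hx⟩
      have hbi : col b = i := by
        by_contra hne
        exact Finset.disjoint_left.1 (hdisj _ _ hne) (he b (hσ.1 hb)) hx
      rw [hσ.2.2.2 hb hm (hbi.trans hmi.symm)]
    · rintro rfl
      exact ⟨⟨m, hm, rfl⟩, hmi ▸ he m (hσ.1 hm)⟩
  let lft : Finset (Finset V) → Finset B := fun M => A.filter (fun b => e b ∈ M)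
  have hlft : ∀ M, IsFullRainbowMatching E Ep M →
      RbF A e col (lft M) ∧ (lft M).image e = M := by
    intro M hM
    have hci : Set.InjOn col (lft M) := by
      intro a ha b hb hab
      simp only [lft, Finset.coe_filter, Set.mem_ofPred_eq] at ha hb
      obtain ⟨x, hx⟩ := Finset.card_eq_one.1 (hM.2 (col a))
      have h1 : e a ∈ M ∩ Ep (col a) := Finset.mem_inter.2 ⟨ha.2, he a ha.1⟩
      have h2 : e b ∈ M ∩ Ep (col a) := Finset.mem_inter.2 ⟨hb.2, hab ▸ he b hb.1⟩
      rw [hx, Finset.mem_singleton] at h1 h2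
      exact hinj ha.1 hb.1 (h1.trans h2.symm)
    refine ⟨⟨Finset.filter_subset _ _, ⟨?_, ?_⟩, ?_, hci⟩, ?_⟩
    · intro u hu v hv huv huA hvA
      simp only [lft, Finset.mem_filter] at hu hv
      exact hM.1.2 _ hu.2 _ hv.2 (fun h => huv (hinj huA hvA h))
    · intro u hu v hv huA
      exact absurd (Finset.mem_filter.1 hu).1 huA
    · rw [← Finset.card_image_of_injOn hci]
      have : (lft M).image col = Finset.univ := by
        apply Finset.eq_univ_of_forall
        intro i
        obtain ⟨x, hx⟩ := Finset.card_eq_one.1 (hM.2 i)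
        have h1 : x ∈ M ∩ Ep i := by rw [hx]; simp
        obtain ⟨b, hb, hbi, rfl⟩ := hsurj i x (Finset.mem_inter.1 h1).2
        exact Finset.mem_image.2 ⟨b, Finset.mem_filter.2 ⟨hb, (Finset.mem_inter.1 h1).1⟩, hbi⟩
      rw [this, Finset.card_univ, Fintype.card_fin]
    · ext x
      simp only [lft, Finset.mem_image, Finset.mem_filter]
      constructor
      · rintro ⟨b, ⟨-, hb⟩, rfl⟩; exact hb
      · intro hx
        have h1 := hM.1.1 hx
        rw [← hcover] at h1
        obtain ⟨i, -, hi⟩ := Finset.mem_biUnion.1 h1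
        obtain ⟨b, hb, -, rfl⟩ := hsurj i x hi
        exact ⟨b, ⟨hb, hx⟩, rfl⟩
  have hsymm : ∀ X Y, FRMAdj E Ep X Y → FRMAdj E Ep Y X := by
    rintro X Y ⟨h1, h2, h3, h4⟩
    exact ⟨h2, h1, Finset.union_comm X Y ▸ h3, Finset.union_comm X Y ▸ h4⟩
  let f : Finset B → ℝ := fun σ =>
    if Relation.ReflTransGen (FRMAdj E Ep) M (σ.image e) then 1 else 0
  have hf : f (lft M) = f (lft M') := by
    refine core_connect A e col hcol d hd hdA hdc r Δ (fun a ha => (huniform _ (heE a ha)).le)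
      ?_ ?_ f ?_ _ _ (hlft M hM).1 (hlft M' hM').1
    · intro x
      refine le_trans (Finset.card_le_card_of_injOn e ?_ ?_) (hΔ x)
      · intro a ha
        simp only [Finset.coe_filter, Set.mem_ofPred_eq] at ha ⊢
        exact ⟨heE a ha.1, ha.2⟩
      · exact hinj.mono (by intro a ha; simp at ha; simp [ha.1])
    · intro i
      refine (hsize i).trans (le_trans (Finset.card_le_card ?_)
        (Finset.card_image_le (f := e)))
      intro x hx
      obtain ⟨b, hb, hbi, rfl⟩ := hsurj i x hx
      exact Finset.mem_image_of_mem _ (Finset.mem_filter.2 ⟨hb, hbi⟩)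
    · intro τ hτ hg hc a ha b hb hab hRa hRb
      have hun : (τ.erase a).image e ∪ (τ.erase b).image e = τ.image e := by
        rw [← Finset.image_union]
        congr 1
        ext x
        simp only [Finset.mem_union, Finset.mem_erase]
        constructor
        · rintro (h | h) <;> exact h.2
        · intro hx
          by_cases hxa : x = a
          · exact Or.inr ⟨hxa ▸ hab, hx⟩
          · exact Or.inl ⟨hxa, hx⟩
      have hadj : FRMAdj E Ep ((τ.erase a).image e) ((τ.erase b).image e) := by
        refine ⟨hfull _ hRa, hfull _ hRb, ?_, ?_⟩
        · rw [hun]; exact hmatch τ hτ hg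
        · rw [hun, Finset.card_image_of_injOn (hinj.mono (by exact_mod_cast hτ)), hc]
      have hiff : Relation.ReflTransGen (FRMAdj E Ep) M ((τ.erase a).image e) ↔
          Relation.ReflTransGen (FRMAdj E Ep) M ((τ.erase b).image e) :=
        ⟨fun h => h.tail hadj, fun h => h.tail (hsymm _ _ hadj)⟩
      simp only [f, hiff]
  simp only [f] at hf
  rw [(hlft M hM).2, (hlft M' hM').2, if_pos Relation.ReflTransGen.refl] at hf
  by_contra hcon
  rw [if_neg hcon] at hf
  exact one_ne_zero hf

end Final

/-- If `G` is an `r`-uniform hypergraph with maximum degree `Δ` and every class of the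
edge partition has size at least `rΔ + 1`, then the reconfiguration graph on full
rainbow matchings is connected. -/
theorem stmt_9 {V : Type*} [Fintype V] [DecidableEq V]
    (E : Finset (Finset V)) (r Δ n : ℕ)
    (huniform : ∀ e ∈ E, e.card = r)
    (hΔ : ∀ v : V, (E.filter fun e => v ∈ e).card ≤ Δ)
    (Ep : Fin n → Finset (Finset V))
    (hne : ∀ i, (Ep i).Nonempty)
    (hdisj : ∀ i j, i ≠ j → Disjoint (Ep i) (Ep j))
    (hcover : Finset.univ.biUnion Ep = E)
    (hsize : ∀ i, r * Δ + 1 ≤ (Ep i).card)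
    (M M' : Finset (Finset V))
    (hM : IsFullRainbowMatching E Ep M) (hM' : IsFullRainbowMatching E Ep M') :
    Relation.ReflTransGen (FRMAdj E Ep) M M' := by
  classical
  let _ : LinearOrder ((i : Fin n) × Option {x // x ∈ Ep i}) :=
    LinearOrder.lift' (fun b => toLex (b.1, Fintype.equivFin _ b)) (by
      intro a b h
      have h2 := congrArg (fun p => (ofLex p).2) h
      exact (Fintype.equivFin _).injective h2)
  refine rainbow_connect (B := (i : Fin n) × Option {x // x ∈ Ep i}) E r Δ huniform hΔ Ep hdisj
    hcover hsize (Finset.univ.filter fun b => b.2.isSome)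
    (fun b => b.2.elim ∅ Subtype.val) (fun b => b.1) ?_ (fun i => ⟨i, none⟩) ?_ ?_ ?_ ?_ ?_ ?_
    M M' hM hM'
  · intro a b h
    have h2 : toLex (a.1, Fintype.equivFin _ a) ≤ toLex (b.1, Fintype.equivFin _ b) := h
    rcases Prod.Lex.toLex_le_toLex.1 h2 with h3 | h3
    · exact h3.le
    · exact h3.1.le
  · rintro ⟨i, _ | x⟩ h
    · rfl
    · simp at h
  · intro i; simp
  · intro i; rfl
  · rintro ⟨i, _ | x⟩ h
    · simp at h
    · exact x.2
  · intro i x hx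
    exact ⟨⟨i, some ⟨x, hx⟩⟩, by simp, rfl, rfl⟩
  · rintro ⟨i, _ | x⟩ h ⟨j, _ | y⟩ h' heq
    · simp at h
    · simp at h
    · simp at h'
    · have hxy : x.1 = y.1 := heq
      have hij : i = j := by
        by_contra hne
        exact Finset.disjoint_left.1 (hdisj i j hne) x.2 (hxy ▸ y.2)
      subst hij
      rw [Subtype.ext hxy]
end

section
/- Let n ≥ 1 and let 𝓔 = {E_1, …, E_n} be a partition of the edge set of the complete bipartite graph K_{n,n} into n classes each of size n. Then for k = ⌈2n/3 − 3/2⌉, the reconfiguration graph RG(M(K_{n,n}), 𝓔; k) on rainbow matchings of size k is connected. -/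
/-- `M` is a matching of the complete bipartite graph `K_{n,n}`, whose edges are
identified with pairs in `Fin n × Fin n`: distinct edges share no endpoint. -/
def KnnMatching {n : ℕ} (M : Finset (Fin n × Fin n)) : Prop :=
  ∀ e ∈ M, ∀ f ∈ M, e ≠ f → e.1 ≠ f.1 ∧ e.2 ≠ f.2

/-- `M` is a rainbow matching of size `k` with respect to the edge partition
`Ep : Fin n → Finset (Fin n × Fin n)` of `K_{n,n}`: a matching of `k` edges containing
at most one edge from each class. -/
def IsRainbowMatching {n : ℕ} (Ep : Fin n → Finset (Fin n × Fin n)) (k : ℕ)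
    (M : Finset (Fin n × Fin n)) : Prop :=
  KnnMatching M ∧ M.card = k ∧ ∀ i, (M ∩ Ep i).card ≤ 1

/-- Adjacency in the reconfiguration graph `RG(𝓜(K_{n,n}), 𝓔; k)`: two rainbow
matchings of size `k` are adjacent if their union is a matching with `k + 1` edges. -/
def RMAdj {n : ℕ} (Ep : Fin n → Finset (Fin n × Fin n)) (k : ℕ)
    (M M' : Finset (Fin n × Fin n)) : Prop :=
  IsRainbowMatching Ep k M ∧ IsRainbowMatching Ep k M' ∧
    KnnMatching (M ∪ M') ∧ (M ∪ M').card = k + 1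

section RMCHelpers

open Finset

namespace RMC

set_option linter.unusedSectionVars false

variable {ε : Type*} [Fintype ε] [DecidableEq ε]

/-- Boundary of a mod 2 chain. -/
def bd (c : Finset ε → ZMod 2) : Finset ε → ZMod 2 :=
  fun τ => ∑ x ∈ τᶜ, c (insert x τ)

/-- Independence for a conflict relation (taken reflexive). -/
def Ind (R : ε → ε → Prop) (σ : Finset ε) : Prop :=
  ∀ e ∈ σ, ∀ f ∈ σ, R e f → e = f

/-- The chain `c` is supported on independent `s`-subsets of `H`. -/
def Sup (R : ε → ε → Prop) (c : Finset ε → ZMod 2) (H : Finset ε) (s : ℕ) : Prop :=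
  ∀ σ, c σ ≠ 0 → σ ⊆ H ∧ Ind R σ ∧ σ.card = s

/-- Vanishing of homology in cardinality `s`. -/
def Van (R : ε → ε → Prop) (H : Finset ε) (s : ℕ) : Prop :=
  ∀ z, Sup R z H s → bd z = 0 → ∃ u, Sup R u H (s + 1) ∧ bd u = z

/-- Cone with apex `g`. -/
def cone (g : ε) (w : Finset ε → ZMod 2) : Finset ε → ZMod 2 :=
  fun σ => if g ∈ σ then w (σ.erase g) else 0

lemma Ind.subset {R : ε → ε → Prop} {σ τ : Finset ε} (h : Ind R τ) (hs : σ ⊆ τ) : Ind R σ :=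
  fun e he f hf => h e (hs he) f (hs hf)

lemma bd_add (c d : Finset ε → ZMod 2) : bd (c + d) = bd c + bd d := by
  funext τ; simp [bd, Finset.sum_add_distrib]

lemma bd_zero : bd (0 : Finset ε → ZMod 2) = 0 := by
  funext τ; simp [bd]

lemma bd_sum {ι : Type*} (s : Finset ι) (c : ι → Finset ε → ZMod 2) :
    bd (∑ i ∈ s, c i) = ∑ i ∈ s, bd (c i) := by
  funext τ
  simp only [bd, Finset.sum_apply]
  rw [Finset.sum_comm]

lemma z2_add_self (a : ZMod 2) : a + a = 0 := CharTwo.add_self_eq_zero a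

lemma bd_bd (c : Finset ε → ZMod 2) : bd (bd c) = 0 := by
  funext τ
  simp only [bd, Pi.zero_apply]
  rw [Finset.sum_sigma']
  apply Finset.sum_involution (fun p _ => ⟨p.2, p.1⟩)
  · rintro ⟨x, y⟩ h
    simp only [Finset.insert_comm y x]
    exact z2_add_self _
  · rintro ⟨x, y⟩ h _ h2
    simp at h h2
    try grind
  · rintro ⟨x, y⟩ h
    rfl
  · rintro ⟨x, y⟩ h
    simp at h ⊢
    grind

lemma bd_cone_mem {g : ε} {w : Finset ε → ZMod 2} (hw : ∀ σ, g ∈ σ → w σ = 0)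
    {τ : Finset ε} (h : g ∈ τ) : bd (cone g w) τ = bd w (τ.erase g) := by
  have h1 : (τ.erase g)ᶜ = insert g τᶜ := by ext x; simp; try grind
  simp only [bd]
  rw [h1, Finset.sum_insert (by simpa using h), hw _ (by simp), zero_add]
  apply Finset.sum_congr rfl
  intro x hx
  simp only [mem_compl] at hx
  have : (insert x τ).erase g = insert x (τ.erase g) := by
    rw [Finset.erase_insert_of_ne]; rintro rfl; exact hx h
  simp [cone, h, this]

lemma bd_cone_notMem {g : ε} {w : Finset ε → ZMod 2}
    {τ : Finset ε} (h : g ∉ τ) : bd (cone g w) τ = w τ := by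
  simp only [bd]
  rw [Finset.sum_eq_single g]
  · simp [cone, h]
  · intro x hx hne
    simp [cone, h, Ne.symm hne]
  · simp [h]

variable {R : ε → ε → Prop}

lemma Sup.add {c d : Finset ε → ZMod 2} {H : Finset ε} {s : ℕ}
    (hc : Sup R c H s) (hd : Sup R d H s) : Sup R (c + d) H s := by
  intro σ h
  by_cases h1 : c σ = 0
  · apply hd; intro h2; apply h; simp [h1, h2]
  · exact hc σ h1

lemma Sup.mono {c : Finset ε → ZMod 2} {H H' : Finset ε} {s : ℕ}
    (hc : Sup R c H s) (h : H ⊆ H') : Sup R c H' s := fun σ hσ =>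
  ⟨(hc σ hσ).1.trans h, (hc σ hσ).2⟩

lemma Sup.sum {ι : Type*} {t : Finset ι} {c : ι → Finset ε → ZMod 2} {H : Finset ε} {s : ℕ}
    (hc : ∀ i ∈ t, Sup R (c i) H s) : Sup R (∑ i ∈ t, c i) H s := by
  intro σ h
  rw [Finset.sum_apply] at h
  obtain ⟨i, hi, h2⟩ := Finset.exists_ne_zero_of_sum_ne_zero h
  exact hc i hi σ h2

lemma Sup.bd {c : Finset ε → ZMod 2} {H : Finset ε} {s : ℕ}
    (hc : Sup R c H (s + 1)) : Sup R (bd c) H s := by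
  intro σ h
  obtain ⟨x, hx, h2⟩ := Finset.exists_ne_zero_of_sum_ne_zero h
  obtain ⟨a, b, d⟩ := hc _ h2
  simp only [mem_compl] at hx
  refine ⟨(subset_insert x σ).trans a, b.subset (subset_insert x σ), ?_⟩
  rw [card_insert_of_notMem hx] at d
  omega

lemma van_zero {H : Finset ε} (hH : H.Nonempty) (R : ε → ε → Prop) : Van R H 0 := by
  obtain ⟨g, hg⟩ := hH
  intro z hz _
  have hz0 : ∀ σ, g ∈ σ → z σ = 0 := by
    intro σ hσ
    by_contra h
    have := (hz σ h).2.2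
    rw [card_eq_zero] at this
    simp [this] at hσ
  refine ⟨cone g z, ?_, ?_⟩
  · intro σ h
    simp only [cone] at h
    split_ifs at h with hσ
    · obtain ⟨-, -, h3⟩ := hz _ h
      rw [card_eq_zero] at h3
      have : σ = {g} := by
        have := insert_erase hσ
        rw [h3] at this
        rw [← this]; rfl
      subst this
      simp [hg, Ind]
    · exact absurd rfl h
  · funext τ
    by_cases hτ : g ∈ τ
    · rw [bd_cone_mem hz0 hτ, hz0 τ hτ]
      simp only [bd]
      apply Finset.sum_eq_zero
      intro x _
      by_contra h
      have := (hz _ h).2.2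
      simp at this
    · exact bd_cone_notMem hτ

lemma elim_one [DecidableRel R] (hrefl : ∀ e, R e e) (hsymm : ∀ e f, R e f → R f e)
    {H : Finset ε} {s : ℕ} {g : ε} (hg : g ∈ H)
    (hV : Van R (H.filter (fun e => ¬ R g e)) s)
    {z : Finset ε → ZMod 2} (hz : Sup R z H (s + 1)) (hb : ∀ τ, g ∈ τ → bd z τ = 0) :
    ∃ y, Sup R y H (s + 2) ∧ Sup R (z + bd y) (H.erase g) (s + 1) := by
  set w : Finset ε → ZMod 2 := fun τ => if g ∈ τ then 0 else z (insert g τ) with hw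
  have hwS : Sup R w (H.filter (fun e => ¬ R g e)) s := by
    intro τ h
    simp only [hw] at h
    split_ifs at h with hτ
    · exact absurd rfl h
    obtain ⟨a, b, d⟩ := hz _ h
    rw [card_insert_of_notMem hτ] at d
    refine ⟨?_, b.subset (subset_insert _ _), by omega⟩
    intro x hx
    rw [mem_filter]
    refine ⟨a (mem_insert_of_mem hx), ?_⟩
    intro hR
    have := b g (mem_insert_self _ _) x (mem_insert_of_mem hx) hR
    exact hτ (this ▸ hx)
  have hwb : bd w = 0 := by
    funext τ
    simp only [Pi.zero_apply]
    by_cases hτ : g ∈ τ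
    · simp only [bd]
      apply Finset.sum_eq_zero
      intro x _
      simp [hw, hτ]
    · rw [← hb (insert g τ) (mem_insert_self _ _)]
      simp only [bd]
      have h1 : τᶜ = insert g (insert g τ)ᶜ := by ext x; simp; grind
      rw [h1, Finset.sum_insert (by simp)]
      simp only [hw, mem_insert_self, if_true, zero_add]
      apply Finset.sum_congr rfl
      intro x hx
      have : g ∉ insert x τ := by simp at hx ⊢; grind
      rw [if_neg this, Finset.insert_comm]
  obtain ⟨u, hu, hub⟩ := hV w hwS hwb
  have hug : ∀ σ, g ∈ σ → u σ = 0 := by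
    intro σ hσ
    by_contra h
    have := (hu σ h).1 hσ
    simp [hrefl] at this
  have hy : Sup R (cone g u) H (s + 2) := by
    intro σ h
    simp only [cone] at h
    split_ifs at h with hσ
    · obtain ⟨a, b, d⟩ := hu _ h
      have hins := insert_erase hσ
      rw [card_erase_of_mem hσ] at d
      refine ⟨?_, ?_, by omega⟩
      · rw [← hins]
        apply insert_subset hg
        exact a.trans (filter_subset _ _)
      · intro e he f hf hR
        by_cases h1 : e = g <;> by_cases h2 : f = g
        · rw [h1, h2]
        · subst h1
          have := a (mem_erase.2 ⟨h2, hf⟩)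
          simp [hR] at this
        · subst h2
          have := a (mem_erase.2 ⟨h1, he⟩)
          simp [hsymm _ _ hR] at this
        · exact b e (mem_erase.2 ⟨h1, he⟩) f (mem_erase.2 ⟨h2, hf⟩) hR
    · exact absurd rfl h
  refine ⟨cone g u, hy, ?_⟩
  intro σ h
  have h3 := (hz.add hy.bd) σ h
  refine ⟨?_, h3.2⟩
  rw [subset_erase]
  refine ⟨h3.1, fun hσ => h ?_⟩
  rw [Pi.add_apply, bd_cone_mem hug hσ, hub]
  simp only [hw, notMem_erase, if_false, insert_erase hσ]
  exact z2_add_self _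

lemma elim_clique [DecidableRel R] (hrefl : ∀ e, R e e) (hsymm : ∀ e f, R e f → R f e)
    {H : Finset ε} {s : ℕ} (T : Finset ε) (hT : T ⊆ H) (hc : ∀ g ∈ T, ∀ e ∈ T, R g e)
    (hV : ∀ g ∈ T, Van R (H.filter (fun e => ¬ R g e)) s)
    {z : Finset ε → ZMod 2} (hz : Sup R z H (s + 1)) (hb : ∀ τ, ∀ g ∈ T, g ∈ τ → bd z τ = 0) :
    ∃ y, Sup R y H (s + 2) ∧ Sup R (z + bd y) (H \ T) (s + 1) := by
  induction T using Finset.induction_on with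
  | empty =>
    refine ⟨0, fun σ h => absurd rfl h, ?_⟩
    simpa [bd_zero] using hz
  | insert g T hgT ih =>
    obtain ⟨y, hy, hyz⟩ := ih ((subset_insert _ _).trans hT)
      (fun a ha b hb => hc a (mem_insert_of_mem ha) b (mem_insert_of_mem hb))
      (fun a ha => hV a (mem_insert_of_mem ha))
      (fun τ a ha => hb τ a (mem_insert_of_mem ha))
    have hf : (H \ T).filter (fun e => ¬ R g e) = H.filter (fun e => ¬ R g e) := by
      ext e
      simp only [mem_filter, mem_sdiff]
      constructor
      · rintro ⟨⟨a, b⟩, c⟩; exact ⟨a, c⟩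
      · rintro ⟨a, c⟩
        exact ⟨⟨a, fun he => c (hc g (mem_insert_self _ _) e (mem_insert_of_mem he))⟩, c⟩
    obtain ⟨y', hy', hyz'⟩ := elim_one hrefl hsymm (H := H \ T) (g := g) (s := s)
      (mem_sdiff.2 ⟨hT (mem_insert_self _ _), hgT⟩)
      (by rw [hf]; exact hV g (mem_insert_self _ _)) hyz
      (by
        intro τ hτ
        rw [bd_add, bd_bd, add_zero]
        exact hb τ g (mem_insert_self _ _) hτ)
    refine ⟨y + y', hy.add (hy'.mono sdiff_subset), ?_⟩
    rw [bd_add, ← add_assoc]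
    have : H \ insert g T = (H \ T).erase g := by ext x; simp; tauto
    rw [this]; exact hyz'

/-- Explosion lemma: neighbours of `f` split in two cliques `B` (processed first) and `A`. -/
lemma explode [DecidableRel R] (hrefl : ∀ e, R e e) (hsymm : ∀ e f, R e f → R f e)
    {H : Finset ε} {s : ℕ} {f : ε} (hf : f ∈ H) (A B : Finset ε)
    (hAH : A ⊆ H.erase f) (hBH : B ⊆ H.erase f)
    (hA : ∀ g ∈ A, ∀ e ∈ A, R g e) (hB : ∀ g ∈ B, ∀ e ∈ B, R g e)
    (hAf : ∀ g ∈ A, R f g) (hBf : ∀ g ∈ B, R f g) (hAB : Disjoint A B)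
    (hcov : ∀ g ∈ H, R f g → g = f ∨ g ∈ A ∨ g ∈ B)
    (hVB : ∀ g ∈ B, Van R ((H.erase f).filter (fun e => ¬ R g e)) s)
    (hVA : ∀ g ∈ A, Van R (((H.erase f) \ B).filter (fun e => ¬ R g e)) s) :
    Van R H (s + 1) := by
  intro z hz hbz
  set z' : Finset ε → ZMod 2 := fun τ => if f ∈ τ then 0 else z τ with hz'
  have hz'S : Sup R z' (H.erase f) (s + 1) := by
    intro σ h
    simp only [hz'] at h
    split_ifs at h with h1
    · exact absurd rfl h
    obtain ⟨a, b⟩ := hz σ h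
    exact ⟨subset_erase.2 ⟨a, h1⟩, b⟩
  have hb1 : ∀ τ, f ∈ τ → bd z' τ = 0 := by
    intro τ hτ
    simp only [bd]
    apply Finset.sum_eq_zero
    intro x _
    simp [hz', hτ]
  have hb2 : ∀ τ, f ∉ τ → bd z' τ = z (insert f τ) := by
    intro τ hτ
    have h0 : bd z τ = 0 := by rw [hbz]; rfl
    have h1 : τᶜ = insert f (insert f τ)ᶜ := by ext x; simp; grind
    simp only [bd] at h0 ⊢
    rw [h1, Finset.sum_insert (by simp)] at h0 ⊢
    have h2 : ∑ x ∈ (insert f τ)ᶜ, z' (insert x τ) = ∑ x ∈ (insert f τ)ᶜ, z (insert x τ) := by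
      apply Finset.sum_congr rfl
      intro x hx
      have : f ∉ insert x τ := by simp at hx ⊢; grind
      simp only [hz']
      rw [if_neg this]
    rw [h2]
    simp only [hz', mem_insert_self, if_true, zero_add]
    rw [← sub_eq_zero, CharTwo.sub_eq_add, add_comm]; exact h0
  have hb3 : ∀ τ, ∀ g, g ≠ f → R f g → g ∈ τ → bd z' τ = 0 := by
    intro τ g hgf hR hgτ
    by_cases hτ : f ∈ τ
    · exact hb1 τ hτ
    · rw [hb2 τ hτ]
      by_contra h
      exact hgf ((hz _ h).2.1 f (mem_insert_self _ _) g (mem_insert_of_mem hgτ) hR).symm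
  obtain ⟨y1, hy1, hs1⟩ := elim_clique hrefl hsymm B hBH hB hVB hz'S
    (fun τ g hg hgτ => hb3 τ g (mem_erase.1 (hBH hg)).1 (hBf g hg) hgτ)
  have hA2 : A ⊆ H.erase f \ B := fun x hx =>
    mem_sdiff.2 ⟨hAH hx, fun h => disjoint_left.1 hAB hx h⟩
  obtain ⟨y2, hy2, hs2⟩ := elim_clique hrefl hsymm A hA2 hA hVA hs1
    (fun τ g hg hgτ => by
      rw [bd_add, bd_bd, add_zero]
      exact hb3 τ g (mem_erase.1 (hAH hg)).1 (hAf g hg) hgτ)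
  set z2 := z' + bd y1 + bd y2 with hz2
  have hbz2 : bd z2 = bd z' := by rw [hz2, bd_add, bd_add, bd_bd, bd_bd]; simp
  have hz2f : ∀ σ, f ∈ σ → z2 σ = 0 := by
    intro σ hσ
    by_contra h
    have := (hs2 σ h).1 hσ
    simp at this
  have hcone : Sup R (cone f z2) H (s + 2) := by
    intro σ h
    simp only [cone] at h
    split_ifs at h with hσ
    · obtain ⟨a, b, d⟩ := hs2 _ h
      have hins := insert_erase hσ
      rw [card_erase_of_mem hσ] at d
      have key : ∀ e ∈ σ, e ≠ f → ¬ R f e := by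
        intro e he hef hR
        have h1 := a (mem_erase.2 ⟨hef, he⟩)
        simp only [mem_sdiff, mem_erase] at h1
        have := hcov e h1.1.1.2 hR
        tauto
      refine ⟨?_, ?_, by omega⟩
      · rw [← hins]
        apply insert_subset hf
        exact (a.trans sdiff_subset).trans (sdiff_subset.trans (erase_subset _ _))
      · intro e he e' he' hR
        by_cases h1 : e = f <;> by_cases h2 : e' = f
        · rw [h1, h2]
        · subst h1; exact absurd hR (key e' he' h2)
        · subst h2; exact absurd (hsymm _ _ hR) (key e he h1)
        · exact b e (mem_erase.2 ⟨h1, he⟩) e' (mem_erase.2 ⟨h2, he'⟩) hR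
    · exact absurd rfl h
  refine ⟨cone f z2 + y1 + y2, (hcone.add (hy1.mono (erase_subset _ _))).add
    (hy2.mono (sdiff_subset.trans (erase_subset _ _))), ?_⟩
  funext τ
  rw [bd_add, bd_add]
  simp only [Pi.add_apply]
  by_cases hτ : f ∈ τ
  · rw [bd_cone_mem hz2f hτ, hbz2, hb2 _ (notMem_erase _ _), insert_erase hτ]
    have h1 : bd y1 τ = 0 := by
      by_contra h
      have := (hy1.bd τ h).1 hτ
      simp at this
    have h2 : bd y2 τ = 0 := by
      by_contra h
      have := (hy2.bd τ h).1 hτ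
      simp at this
    rw [h1, h2]; simp
  · rw [bd_cone_notMem hτ]
    simp only [hz2, Pi.add_apply, hz', if_neg hτ]
    linear_combination z2_add_self (bd y1 τ) + z2_add_self (bd y2 τ)

end RMC
namespace RMC

set_option linter.unusedSectionVars false

variable {ε α β : Type*} [Fintype ε] [DecidableEq ε] [DecidableEq α] [DecidableEq β]

/-- Two edges conflict when they share an endpoint. -/
abbrev Rl (l : ε → α) (r : ε → β) (e f : ε) : Prop := l e = l f ∨ r e = r f

lemma explode_lr {l : ε → α} {r : ε → β} (hinj : ∀ e f, l e = l f → r e = r f → e = f)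
    {H : Finset ε} {s : ℕ} {f : ε} (hf : f ∈ H)
    (hB : ∀ g ∈ H, g ≠ f → r g = r f → Van (Rl l r) (H.filter (fun e => ¬ Rl l r g e)) s)
    (hA : ∀ g ∈ H, g ≠ f → l g = l f →
      Van (Rl l r) (H.filter (fun e => ¬ Rl l r g e ∧ ¬ Rl l r f e)) s) :
    Van (Rl l r) H (s + 1) := by
  apply explode (R := Rl l r) (fun e => Or.inl rfl)
    (fun e f h => h.imp Eq.symm Eq.symm) hf
    ((H.erase f).filter (fun e => l e = l f)) ((H.erase f).filter (fun e => r e = r f))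
    (filter_subset _ _) (filter_subset _ _)
  · intro g hg e he
    simp only [mem_filter] at hg he
    exact Or.inl (hg.2.trans he.2.symm)
  · intro g hg e he
    simp only [mem_filter] at hg he
    exact Or.inr (hg.2.trans he.2.symm)
  · intro g hg
    simp only [mem_filter] at hg
    exact Or.inl hg.2.symm
  · intro g hg
    simp only [mem_filter] at hg
    exact Or.inr hg.2.symm
  · rw [disjoint_left]
    intro g hg hg'
    simp only [mem_filter, mem_erase] at hg hg'
    exact hg.1.1 (hinj _ _ hg.2 hg'.2)
  · intro g hg hR
    by_cases h : g = f
    · exact Or.inl h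
    · right
      simp only [mem_filter, mem_erase]
      rcases hR with h1 | h1
      · exact Or.inl ⟨⟨h, hg⟩, h1.symm⟩
      · exact Or.inr ⟨⟨h, hg⟩, h1.symm⟩
  · intro g hg
    simp only [mem_filter, mem_erase] at hg
    have := hB g hg.1.2 hg.1.1 hg.2
    convert this using 1
    ext e
    simp only [mem_filter, mem_erase]
    constructor
    · tauto
    · rintro ⟨a, b⟩
      refine ⟨⟨?_, a⟩, b⟩
      rintro rfl
      exact b (Or.inr hg.2)
  · intro g hg
    simp only [mem_filter, mem_erase] at hg
    have := hA g hg.1.2 hg.1.1 hg.2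
    convert this using 1
    ext e
    simp only [mem_filter, mem_erase, mem_sdiff, Rl]
    constructor
    · rintro ⟨⟨⟨a, b⟩, c⟩, d⟩
      refine ⟨b, d, ?_⟩
      rintro (h | h)
      · exact d (Or.inl (hg.2.trans h))
      · exact c ⟨⟨a, b⟩, h.symm⟩
    · rintro ⟨a, b, c⟩
      refine ⟨⟨⟨?_, a⟩, ?_⟩, b⟩
      · rintro rfl
        exact c (Or.inl rfl)
      · rintro ⟨-, h⟩
        exact c (Or.inr h.symm)

/-- Half of the matching number bounds the connectivity. -/
lemma van_of_matching {l : ε → α} {r : ε → β} (hinj : ∀ e f, l e = l f → r e = r f → e = f)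
    (s : ℕ) : ∀ (H P : Finset ε), P ⊆ H → Ind (Rl l r) P → 2 * s + 1 ≤ P.card →
    Van (Rl l r) H s := by
  induction s with
  | zero =>
    intro H P hPH _ hc
    apply van_zero
    have : P.Nonempty := card_pos.1 (by omega)
    exact this.mono hPH
  | succ s ih =>
    intro H P hPH hP hc
    have hne : P.Nonempty := card_pos.1 (by omega)
    obtain ⟨f, hf⟩ := hne
    have one_l : ∀ a : α, (P.filter (fun e => a = l e)).card ≤ 1 := by
      intro a
      rw [card_le_one]
      intro x hx y hy
      simp only [mem_filter] at hx hy
      exact hP x hx.1 y hy.1 (Or.inl (hx.2.symm.trans hy.2))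
    have one_r : ∀ a : β, (P.filter (fun e => a = r e)).card ≤ 1 := by
      intro a
      rw [card_le_one]
      intro x hx y hy
      simp only [mem_filter] at hx hy
      exact hP x hx.1 y hy.1 (Or.inr (hx.2.symm.trans hy.2))
    have two : ∀ g, 2 * s + 1 ≤ (P.filter (fun e => ¬ Rl l r g e)).card := by
      intro g
      have h1 := card_filter_add_card_filter_not (s := P) (fun e => Rl l r g e)
      have h2 : (P.filter (fun e => Rl l r g e)).card ≤ 2 := by
        rw [filter_or]
        have := card_union_le (P.filter (fun e => l g = l e)) (P.filter (fun e => r g = r e))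
        have := one_l (l g)
        have := one_r (r g)
        omega
      omega
    apply explode_lr hinj (hPH hf)
    · intro g hg hgf hr
      exact ih _ (P.filter (fun e => ¬ Rl l r g e)) (filter_subset_filter _ hPH)
        (hP.subset (filter_subset _ _)) (two g)
    · intro g hg hgf hl
      refine ih _ (P.filter (fun e => ¬ Rl l r g e)) ?_
        (hP.subset (filter_subset _ _)) (two g)
      intro e he
      simp only [mem_filter] at he ⊢
      refine ⟨hPH he.1, he.2, fun hR => ?_⟩
      have := hP f hf e he.1 hR
      subst this
      exact he.2 (Or.inl hl)

lemma exists_matching {l : ε → α} {r : ε → β} (hinj : ∀ e f, l e = l f → r e = r f → e = f)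
    (H : Finset ε) (N t : ℕ) (hN : 0 < N) (hl : (H.image l).card ≤ N) (hr : (H.image r).card ≤ N)
    (h : t * N < H.card) : ∃ P ⊆ H, Ind (Rl l r) P ∧ t + 1 ≤ P.card := by
  have : NeZero N := ⟨hN.ne'⟩
  obtain ⟨φ⟩ : Nonempty ((H.image l : Finset α) ↪ ZMod N) := by
    apply Function.Embedding.nonempty_of_card_le
    simpa [ZMod.card] using hl
  obtain ⟨ψ⟩ : Nonempty ((H.image r : Finset β) ↪ ZMod N) := by
    apply Function.Embedding.nonempty_of_card_le
    simpa [ZMod.card] using hr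
  let F : ε → ZMod N := fun e => if he : e ∈ H then
    φ ⟨l e, mem_image_of_mem l he⟩ - ψ ⟨r e, mem_image_of_mem r he⟩ else 0
  obtain ⟨y, -, hy⟩ := exists_lt_card_fiber_of_mul_lt_card_of_maps_to (s := H)
    (t := (Finset.univ : Finset (ZMod N))) (f := F) (n := t) (fun _ _ => mem_univ _)
    (by rw [card_univ, ZMod.card, mul_comm]; exact h)
  refine ⟨H.filter (fun e => F e = y), filter_subset _ _, ?_, hy⟩
  intro e he f hf hR
  simp only [mem_filter] at he hf
  have h1 := he.2.trans hf.2.symm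
  simp only [F, dif_pos he.1, dif_pos hf.1] at h1
  rcases hR with h2 | h2
  · have : (⟨l e, mem_image_of_mem l he.1⟩ : (H.image l : Finset α)) =
        ⟨l f, mem_image_of_mem l hf.1⟩ := Subtype.ext h2
    rw [this] at h1
    have := ψ.injective (sub_right_injective h1)
    exact hinj _ _ h2 (congrArg Subtype.val this)
  · have : (⟨r e, mem_image_of_mem r he.1⟩ : (H.image r : Finset β)) =
        ⟨r f, mem_image_of_mem r hf.1⟩ := Subtype.ext h2
    rw [this] at h1
    have := φ.injective (sub_left_injective h1)
    exact hinj _ _ (congrArg Subtype.val this) h2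

/-- degree of left vertex -/
def dl (l : ε → α) (H : Finset ε) (a : α) : ℕ := (H.filter (fun e => l e = a)).card

lemma dl_le {l : ε → α} {r : ε → β} (hinj : ∀ e f, l e = l f → r e = r f → e = f)
    (H : Finset ε) (a : α) : dl l H a ≤ (H.image r).card := by
  unfold dl
  apply card_le_card_of_injOn r
  · intro e he
    simp only [coe_filter, Set.mem_ofPred_eq] at he
    exact mem_image_of_mem r he.1
  · intro e he f hf h
    simp only [coe_filter, Set.mem_ofPred_eq] at he hf
    exact hinj _ _ (he.2.trans hf.2.symm) h

lemma sum_dl (l : ε → α) (H : Finset ε) : ∑ a ∈ H.image l, (dl l H a : ℤ) = H.card := by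
  rw [card_eq_sum_card_image l H]
  push_cast
  rfl

lemma sum_fiber (l : ε → α) (H : Finset ε) (F : α → ℤ) :
    ∑ e ∈ H, F (l e) = ∑ a ∈ H.image l, (dl l H a : ℤ) * F a := by
  rw [← sum_fiberwise_of_maps_to (g := l) (t := H.image l) (fun e he => mem_image_of_mem l he)]
  apply sum_congr rfl
  intro a _
  rw [sum_congr rfl (g := fun _ => F a)]
  · simp [dl]
  · intro e he
    simp only [mem_filter] at he
    rw [he.2]

lemma edge_arith (P Q S X j h : ℤ) (hS : S = P + Q) (hPQ : P ≤ Q) (hQP : Q ≤ P + 1)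
    (hX : 12 * X ≤ S ^ 2) (hj0 : 0 ≤ j) (hS0 : 0 < S) (hhX : h = P * Q - X)
    (hxX : 0 ≤ X - j * Q) (hX0 : 0 ≤ X) :
    3 * X * h ≤ (S * Q - 3 * X + 2 * j * S) * (X - j * Q) + (S * P - 3 * X + j * S) * X
      + S * (j * h) := by
  have e2 : (S * Q - 3 * X + 2 * j * S) * (X - j * Q) + (S * P - 3 * X + j * S) * X
      + S * (j * h) - 3 * X * h =
      X * (S ^ 2 - 3 * (P * Q) - 3 * X) + j * (3 * X * Q + 2 * S * (X - j * Q)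
        - S * Q * (Q - P)) := by
    rw [hhX, hS]; ring
  have e3 : 0 ≤ S ^ 2 - 3 * (P * Q) - 3 * X := by
    rw [hS] at hX ⊢
    nlinarith [sq_nonneg (P - Q)]
  have e4 : 0 ≤ j * (3 * X * Q + 2 * S * (X - j * Q) - S * Q * (Q - P)) := by
    rcases hj0.eq_or_lt with h0 | h0
    · rw [← h0]; simp
    · apply mul_nonneg hj0
      have hQ0 : 0 < Q := by omega
      have q1 : Q ≤ X := by
        have : 1 * Q ≤ j * Q := mul_le_mul_of_nonneg_right (by omega) hQ0.le
        linarith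
      have q2 : S * Q * (Q - P) ≤ S * Q * 1 :=
        mul_le_mul_of_nonneg_left (by omega) (mul_pos hS0 hQ0).le
      have q3 : S * Q ≤ 3 * X * Q := mul_le_mul_of_nonneg_right (by omega) hQ0.le
      have q4 := mul_nonneg hS0.le hxX
      linarith
  have e5 := mul_nonneg hX0 e3
  linarith

/-- Choice of an edge of small degree. -/
lemma exists_edge {l : ε → α} {r : ε → β} (hinj : ∀ e f, l e = l f → r e = r f → e = f)
    (H : Finset ε) (P Q : ℤ) (hne : H.Nonempty) (hPQ : P ≤ Q) (hQP : Q ≤ P + 1)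
    (hl : ((H.image l).card : ℤ) ≤ P) (hr : ((H.image r).card : ℤ) = Q)
    (hX : 12 * (P * Q - H.card) ≤ (P + Q) ^ 2) :
    ∃ f ∈ H, 3 * (P * Q - H.card) ≤ (P + Q) * ((Q - dl l H (l f)) + (P - dl r H (r f))
      + (P - (H.image l).card)) := by
  by_contra hcon
  push Not at hcon
  set h : ℤ := ((H.card : ℕ) : ℤ) with hh
  set p : ℤ := (((H.image l).card : ℕ) : ℤ) with hp
  have hdl : ∀ a, (dl l H a : ℤ) ≤ Q := fun a => by
    rw [← hr]; exact_mod_cast dl_le hinj H a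
  have hdr : ∀ b, (dl r H b : ℤ) ≤ p := fun b => by
    rw [hp]; exact_mod_cast dl_le (l := r) (r := l) (fun e f h1 h2 => hinj e f h2 h1) H b
  have hsl := sum_dl l H
  have hsr := sum_dl r H
  have hp0 : 0 < p := by
    have : 0 < (H.image l).card := card_pos.2 (hne.image l)
    omega
  have hh0 : 0 < h := by
    have : 0 < H.card := card_pos.2 hne
    omega
  set S : ℤ := P + Q with hS
  set X : ℤ := P * Q - h with hXd
  set j : ℤ := P - p with hj
  have hS0 : 0 < S := by omega
  -- total
  have tot : S * (∑ a ∈ H.image l, (dl l H a : ℤ) * (Q - dl l H a)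
      + ∑ b ∈ H.image r, (dl r H b : ℤ) * (P - dl r H b) + j * h) < 3 * X * h := by
    rw [← sum_fiber l H (fun a => Q - dl l H a), ← sum_fiber r H (fun b => P - dl r H b)]
    have h1 : ∑ e ∈ H, S * ((Q - dl l H (l e)) + (P - dl r H (r e)) + j) < ∑ e ∈ H, 3 * X :=
      sum_lt_sum_of_nonempty hne (fun e he => hcon e he)
    rw [← mul_sum, sum_add_distrib, sum_add_distrib] at h1
    simp only [sum_const, nsmul_eq_mul] at h1
    rw [← hh] at h1
    linarith
  have pa : (S * Q - 3 * X + 2 * j * S) * (p * Q - h) ≤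
      S * ∑ a ∈ H.image l, (dl l H a : ℤ) * (Q - dl l H a) := by
    have h1 : ∑ a ∈ H.image l, (Q - dl l H a : ℤ) = p * Q - h := by
      rw [sum_sub_distrib, hsl, sum_const, nsmul_eq_mul]
    rw [← h1, mul_sum, mul_sum]
    apply sum_le_sum
    intro a ha
    obtain ⟨e, he, rfl⟩ := mem_image.1 ha
    have h2 := hcon e he
    have h3 := hdl (l e)
    have h4 := hdr (r e)
    rw [← mul_assoc]
    apply mul_le_mul_of_nonneg_right _ (by linarith)
    have h5 : S * j ≤ S * (P - dl r H (r e)) := by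
      apply mul_le_mul_of_nonneg_left _ hS0.le
      linarith
    nlinarith
  have pb : (S * P - 3 * X + j * S) * X ≤
      S * ∑ b ∈ H.image r, (dl r H b : ℤ) * (P - dl r H b) := by
    have h1 : ∑ b ∈ H.image r, (P - dl r H b : ℤ) = X := by
      rw [sum_sub_distrib, hsr, sum_const, nsmul_eq_mul, hr, hXd]; ring
    have h0 : (S * P - 3 * X + j * S) * X =
        ∑ b ∈ H.image r, (S * P - 3 * X + j * S) * (P - dl r H b : ℤ) := by
      rw [← mul_sum, h1]
    rw [h0, mul_sum]
    apply sum_le_sum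
    intro b hb
    obtain ⟨e, he, rfl⟩ := mem_image.1 hb
    have h2 := hcon e he
    have h3 := hdl (l e)
    have h4 := hdr (r e)
    rw [← mul_assoc]
    apply mul_le_mul_of_nonneg_right _ (by linarith)
    have h5 : 0 ≤ S * (Q - dl l H (l e)) := by
      apply mul_nonneg hS0.le
      linarith
    nlinarith
  have hx : 0 ≤ p * Q - h := by
    have h1 : ∑ a ∈ H.image l, (Q - dl l H a : ℤ) = p * Q - h := by
      rw [sum_sub_distrib, hsl, sum_const, nsmul_eq_mul]
    rw [← h1]
    exact sum_nonneg (fun a _ => by linarith [hdl a])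
  have hj0 : 0 ≤ j := by omega
  have hpj : p = P - j := by omega
  have hhX : h = P * Q - X := by rw [hXd]; ring
  have hxX : 0 ≤ X - j * Q := by
    have : p * Q - h = X - j * Q := by rw [hpj, hhX]; ring
    linarith
  have hX0 : 0 ≤ X := by nlinarith
  -- final inequality
  have e1 : (S * Q - 3 * X + 2 * j * S) * (X - j * Q) + (S * P - 3 * X + j * S) * X
      + S * (j * h) < 3 * X * h := by
    have : p * Q - h = X - j * Q := by rw [hpj, hhX]; ring
    rw [this] at pa
    linarith
  exact absurd e1 (not_lt.2 (edge_arith P Q S X j h hS hPQ hQP hX hj0 hS0 hhX hxX hX0))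

end RMC
namespace RMC

set_option linter.unusedSectionVars false

variable {ε α : Type*} [Fintype ε] [DecidableEq ε] [DecidableEq α]

/-- The numeric connectivity bound. -/
def Claim (ε α : Type*) [Fintype ε] [DecidableEq ε] [DecidableEq α] (s m : ℕ) : Prop :=
  ∀ (l r : ε → α), (∀ e f, l e = l f → r e = r f → e = f) →
  ∀ (H : Finset ε) (P Q : ℕ), P + Q = m → 1 ≤ m → P ≤ Q + 1 → Q ≤ P + 1 →
  (H.image l).card ≤ P → (H.image r).card ≤ Q →
  (6 * ((P : ℤ) * Q - H.card) + 3 * m * (s + 1) ≤ (m : ℤ) ^ 2 + m) → Van (Rl l r) H s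

lemma Rl_swap (l r : ε → α) : Rl r l = Rl l r := by
  funext e f
  simp [Rl, or_comm]

lemma claim_of_half (s m : ℕ)
    (h : ∀ (l r : ε → α), (∀ e f, l e = l f → r e = r f → e = f) →
      ∀ (H : Finset ε) (P Q : ℕ), P + Q = m → 1 ≤ m → P ≤ Q → Q ≤ P + 1 →
      (H.image l).card ≤ P → (H.image r).card ≤ Q →
      (6 * ((P : ℤ) * Q - H.card) + 3 * m * (s + 1) ≤ (m : ℤ) ^ 2 + m) → Van (Rl l r) H s) :
    Claim ε α s m := by
  intro l r hinj H P Q hm h1 hPQ hQP hl hr hc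
  rcases le_total P Q with h2 | h2
  · exact h l r hinj H P Q hm h1 h2 hQP hl hr hc
  · have := h r l (fun e f a b => hinj e f b a) H Q P (by omega) h1 h2 hPQ hr hl
      (by rw [mul_comm (Q : ℤ)]; exact hc)
    rwa [Rl_swap] at this

lemma claim_zero (m : ℕ) : Claim ε α 0 m := by
  apply claim_of_half
  intro l r hinj H P Q hm h1 hPQ hQP hl hr hc
  apply van_zero
  rw [← card_pos]
  have hm' : (m : ℤ) = P + Q := by exact_mod_cast hm.symm
  rw [hm'] at hc
  have a1 : (P : ℤ) ≤ Q := by exact_mod_cast hPQ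
  have a2 : (Q : ℤ) ≤ P + 1 := by exact_mod_cast hQP
  have a3 : (1 : ℤ) ≤ P + Q := by exact_mod_cast hm ▸ h1
  by_contra h
  have h0 : (H.card : ℤ) = 0 := by exact_mod_cast (by omega : H.card = 0)
  rw [h0] at hc
  have a4 : (0 : ℤ) ≤ P := by positivity
  rcases (by omega : (Q : ℤ) = P ∨ (Q : ℤ) = P + 1) with h2 | h2
  · rw [h2] at hc a3; push_cast at hc; nlinarith
  · rw [h2] at hc a3; push_cast at hc; nlinarith

lemma sparse_arith (P Q h m s : ℤ) (hm : m = P + Q) (h1 : 1 ≤ m) (hP : 0 ≤ P) (hs : 0 ≤ s)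
    (hPQ : P ≤ Q) (hQP : Q ≤ P + 1)
    (hc : 6 * (P * Q - h) + 3 * m * (s + 1) ≤ m ^ 2 + m)
    (hsp : m * (m - 2) < 12 * (P * Q - h)) : 2 * s * Q < h := by
  have k1 : m * (6 * (s + 1)) < m * (m + 4) := by nlinarith
  have k2 : 6 * (s + 1) < m + 4 := lt_of_mul_lt_mul_left k1 (by omega)
  rcases (by omega : Q = P ∨ Q = P + 1) with h2 | h2
  · subst h2
    subst hm
    have : 0 < Q := by omega
    nlinarith
  · subst h2
    subst hm
    have k3 : 3 * s ≤ P - 1 := by omega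
    nlinarith

lemma van_half (s m : ℕ) (ihs : ∀ m', Claim ε α s m')
    (ihm : ∀ m', m' + 1 = m → Claim ε α (s + 1) m')
    (l r : ε → α) (hinj : ∀ e f, l e = l f → r e = r f → e = f)
    (H : Finset ε) (P Q : ℕ) (hm : P + Q = m) (h1 : 1 ≤ m) (hPQ : P ≤ Q) (hQP : Q ≤ P + 1)
    (hl : (H.image l).card ≤ P) (hr : (H.image r).card ≤ Q)
    (hc : 6 * ((P : ℤ) * Q - H.card) + 3 * m * ((s + 1 : ℕ) + 1) ≤ (m : ℤ) ^ 2 + m) :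
    Van (Rl l r) H (s + 1) := by
  have hm' : (m : ℤ) = P + Q := by exact_mod_cast hm.symm
  have a1 : (P : ℤ) ≤ Q := by exact_mod_cast hPQ
  have a2 : (Q : ℤ) ≤ P + 1 := by exact_mod_cast hQP
  have a3 : (1 : ℤ) ≤ m := by exact_mod_cast h1
  have hinj' : ∀ e f, r e = r f → l e = l f → e = f := fun e f a b => hinj e f b a
  push_cast at hc
  -- the sparse case
  by_cases hsp : (m : ℤ) * (m - 2) < 12 * (P * Q - H.card)
  · have h2 := sparse_arith P Q H.card m (s + 1) hm' a3 (by positivity) (by positivity) a1 a2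
      (by linarith) hsp
    obtain ⟨M, hM, hMi, hMc⟩ := exists_matching hinj H Q (2 * (s + 1)) (by omega)
      (hl.trans hPQ) hr (by exact_mod_cast h2)
    exact van_of_matching hinj (s + 1) H M hM hMi hMc
  push Not at hsp
  have hle : (H.card : ℤ) ≤ P * Q := by
    have h3 : H.card ≤ (H.image l).card * (H.image r).card := by
      rw [← card_product]
      apply card_le_card_of_injOn (fun e => (l e, r e))
      · intro e he
        simp only [coe_product, Set.mem_prod]
        exact ⟨mem_coe.2 (mem_image_of_mem l he), mem_coe.2 (mem_image_of_mem r he)⟩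
      · intro e _ f _ h
        simp only [Prod.mk.injEq] at h
        exact hinj _ _ h.1 h.2
    exact_mod_cast h3.trans (Nat.mul_le_mul hl hr)
  have hm5 : (5 : ℤ) ≤ m := by
    have : (m : ℤ) * (3 * (s + 2)) ≤ m * (m + 1) := by nlinarith
    have := le_of_mul_le_mul_left this (by omega)
    omega
  -- isolated vertex in the larger side
  rcases hr.lt_or_eq with hrl | hreq
  · refine ihm (m - 1) (by omega) l r hinj H P (Q - 1) (by omega) (by omega) (by omega) (by omega)
      hl (by omega) ?_
    have c1 : ((Q - 1 : ℕ) : ℤ) = Q - 1 := by omega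
    have c2 : ((m - 1 : ℕ) : ℤ) = m - 1 := by omega
    rw [c1, c2]
    push_cast
    nlinarith
  have hne : H.Nonempty := by
    rw [nonempty_iff_ne_empty]
    rintro rfl
    simp at hreq
    omega
  obtain ⟨f, hf, hfd⟩ := exists_edge hinj H P Q hne a1 a2 (by exact_mod_cast hl)
    (by exact_mod_cast hreq) (by rw [← hm']; nlinarith)
  rw [← hm'] at hfd
  set X : ℤ := P * Q - H.card with hX
  have hX0 : 0 ≤ X := by linarith
  have hdr : ∀ b, dl r H b ≤ (H.image l).card := fun b => dl_le hinj' H b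
  have hdl : ∀ a, dl l H a ≤ (H.image r).card := fun a => dl_le hinj H a
  apply explode_lr hinj hf
  · intro g hg hgf hgr
    set H' := H.filter (fun e => ¬ Rl l r g e) with hH'
    refine ihs (m - 2) l r hinj H' (P - 1) (Q - 1) (by omega) (by omega) (by omega) (by omega)
      ?_ ?_ ?_
    · have : H'.image l ⊆ (H.image l).erase (l g) := by
        intro a ha
        obtain ⟨e, he, rfl⟩ := mem_image.1 ha
        simp only [hH', mem_filter, Rl] at he
        exact mem_erase.2 ⟨fun h => he.2 (Or.inl h.symm), mem_image_of_mem l he.1⟩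
      have h2 := card_le_card this
      rw [card_erase_of_mem (mem_image_of_mem l hg)] at h2
      omega
    · have : H'.image r ⊆ (H.image r).erase (r g) := by
        intro a ha
        obtain ⟨e, he, rfl⟩ := mem_image.1 ha
        simp only [hH', mem_filter, Rl] at he
        exact mem_erase.2 ⟨fun h => he.2 (Or.inr h.symm), mem_image_of_mem r he.1⟩
      have h2 := card_le_card this
      rw [card_erase_of_mem (mem_image_of_mem r hg)] at h2
      omega
    · have hcard : H.card + 1 ≤ H'.card + P + Q := by
        have h2 : H ⊆ H' ∪ (H.filter (fun e => l e = l g) ∪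
            (H.filter (fun e => r e = r g)).erase g) := by
          intro e he
          simp only [hH', mem_union, mem_filter, mem_erase, Rl]
          by_cases q1 : l e = l g
          · simp [he, q1]
          · by_cases q2 : r e = r g
            · have : e ≠ g := by rintro rfl; exact q1 rfl
              simp [he, q2, this]
            · simp [he, Ne.symm q1, Ne.symm q2]
        have h3 := card_le_card h2
        have h4 := card_union_le H' (H.filter (fun e => l e = l g) ∪
            (H.filter (fun e => r e = r g)).erase g)
        have h5 := card_union_le (H.filter (fun e => l e = l g))
            ((H.filter (fun e => r e = r g)).erase g)
        have h6 := card_erase_add_one (s := H.filter (fun e => r e = r g)) (a := g)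
          (by simp [hg])
        have h7 := hdl (l g)
        have h8 := hdr (r g)
        unfold dl at h7 h8
        omega
      have hcard' : (H.card : ℤ) + 1 ≤ H'.card + P + Q := by exact_mod_cast hcard
      have c0 : ((P - 1 : ℕ) : ℤ) = P - 1 := by omega
      have c1 : ((Q - 1 : ℕ) : ℤ) = Q - 1 := by omega
      have c2 : ((m - 2 : ℕ) : ℤ) = m - 2 := by omega
      rw [c0, c1, c2]
      have hX' : ((P : ℤ) - 1) * (Q - 1) - H'.card ≤ X := by rw [hX]; linarith
      -- 6X ≤ m (m - 2 - 3 (s+1))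
      have g1 : 6 * X ≤ m * (m - 2 - 3 * (s + 1)) := by linarith
      have g2 : m * (6 * X) ≤ m * ((m - 2) * (m - 1 - 3 * (s + 1))) := by
        have : (m - 2) * (6 * X) ≤ (m - 2) * (m * (m - 2 - 3 * (s + 1))) :=
          mul_le_mul_of_nonneg_left g1 (by omega)
        linarith
      have g3 := le_of_mul_le_mul_left g2 (by omega)
      linarith
  · intro g hg hgf hgl
    have hgr : r g ≠ r f := fun h => hgf (hinj _ _ hgl h)
    set H' := H.filter (fun e => ¬ Rl l r g e ∧ ¬ Rl l r f e) with hH'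
    have q0 : 2 ≤ Q := by omega
    refine ihs (m - 3) l r hinj H' (P - 1) (Q - 2) (by omega) (by omega) (by omega) (by omega)
      ?_ ?_ ?_
    · have : H'.image l ⊆ (H.image l).erase (l g) := by
        intro a ha
        obtain ⟨e, he, rfl⟩ := mem_image.1 ha
        simp only [hH', mem_filter, Rl] at he
        exact mem_erase.2 ⟨fun h => he.2.1 (Or.inl h.symm), mem_image_of_mem l he.1⟩
      have h2 := card_le_card this
      rw [card_erase_of_mem (mem_image_of_mem l hg)] at h2
      omega
    · have : H'.image r ⊆ ((H.image r).erase (r g)).erase (r f) := by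
        intro a ha
        obtain ⟨e, he, rfl⟩ := mem_image.1 ha
        simp only [hH', mem_filter, Rl] at he
        exact mem_erase.2 ⟨fun h => he.2.2 (Or.inr h.symm),
          mem_erase.2 ⟨fun h => he.2.1 (Or.inr h.symm), mem_image_of_mem r he.1⟩⟩
      have h2 := card_le_card this
      rw [card_erase_of_mem (mem_erase.2 ⟨hgr.symm, mem_image_of_mem r hf⟩),
        card_erase_of_mem (mem_image_of_mem r hg)] at h2
      omega
    · have hcard : H.card + 2 ≤ H'.card + dl l H (l f) + dl r H (r f) + (H.image l).card := by
        have h2 : H ⊆ H' ∪ (H.filter (fun e => l e = l f) ∪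
            ((H.filter (fun e => r e = r f)).erase f ∪
              (H.filter (fun e => r e = r g)).erase g)) := by
          intro e he
          simp only [hH', mem_union, mem_filter, mem_erase, Rl]
          by_cases q1 : l e = l f
          · simp [he, q1]
          · have e1 : e ≠ f := by rintro rfl; exact q1 rfl
            have e2 : e ≠ g := by rintro rfl; exact q1 hgl
            have q1' : ¬ l f = l e := Ne.symm q1
            by_cases q2 : r e = r g
            · simp [he, q2, e2]
            · by_cases q3 : r e = r f
              · simp [he, q3, e1]
              · simp [he, q1', hgl, Ne.symm q2, Ne.symm q3]
        have h3 := card_le_card h2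
        have h4 := card_union_le H' (H.filter (fun e => l e = l f) ∪
            ((H.filter (fun e => r e = r f)).erase f ∪
              (H.filter (fun e => r e = r g)).erase g))
        have h5 := card_union_le (H.filter (fun e => l e = l f))
            ((H.filter (fun e => r e = r f)).erase f ∪
              (H.filter (fun e => r e = r g)).erase g)
        have h5' := card_union_le ((H.filter (fun e => r e = r f)).erase f)
              ((H.filter (fun e => r e = r g)).erase g)
        have h6 := card_erase_add_one (s := H.filter (fun e => r e = r g)) (a := g)
          (by simp [hg])
        have h6' := card_erase_add_one (s := H.filter (fun e => r e = r f)) (a := f)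
          (by simp [hf])
        have h8 := hdr (r g)
        unfold dl at h8 ⊢
        omega
      have hcard' : (H.card : ℤ) + 2 ≤ H'.card + dl l H (l f) + dl r H (r f)
        + (H.image l).card := by exact_mod_cast hcard
      have c0 : ((P - 1 : ℕ) : ℤ) = P - 1 := by omega
      have c1 : ((Q - 2 : ℕ) : ℤ) = Q - 2 := by omega
      have c2 : ((m - 3 : ℕ) : ℤ) = m - 3 := by omega
      rw [c0, c1, c2]
      set ρ : ℤ := (Q - dl l H (l f)) + (P - dl r H (r f)) + (P - (H.image l).card) with hρ
      have hX' : ((P : ℤ) - 1) * (Q - 2) - H'.card ≤ X - ρ := by rw [hX, hρ]; linarith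
      have g1 : 6 * X ≤ m * (m - 2 - 3 * (s + 1)) := by linarith
      have g2 : m * (6 * (X - ρ)) ≤ m * ((m - 3) * (m - 2 - 3 * (s + 1))) := by
        have : (m - 3) * (6 * X) ≤ (m - 3) * (m * (m - 2 - 3 * (s + 1))) :=
          mul_le_mul_of_nonneg_left g1 (by omega)
        linarith
      have g3 := le_of_mul_le_mul_left g2 (by omega)
      linarith

lemma claim_all (s : ℕ) : ∀ m, Claim ε α s m := by
  induction s with
  | zero => exact claim_zero
  | succ s ihs =>
    intro m
    induction m with
    | zero =>
      intro l r hinj H P Q hm h1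
      omega
    | succ m ihm =>
      apply claim_of_half
      intro l r hinj H P Q hm h1 hPQ hQP hl hr hc
      exact van_half s (m + 1) ihs (fun m' h => by
        obtain rfl : m' = m := by omega
        exact ihm) l r hinj H P Q hm h1 hPQ hQP hl hr hc

end RMC
namespace RMC

set_option linter.unusedSectionVars false

variable {ε C : Type*} [Fintype ε] [DecidableEq ε] [Fintype C] [DecidableEq C]

/-- Elements whose colour lies in `I`. -/
def HI (col : ε → C) (I : Finset C) : Finset ε := univ.filter (fun e => col e ∈ I)

lemma HI_mono (col : ε → C) {I J : Finset C} (h : I ⊆ J) : HI col I ⊆ HI col J := by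
  intro e he
  simp only [HI, mem_filter, mem_univ, true_and] at he ⊢
  exact h he

lemma sum_sum_erase {V : Type*} [AddCommGroup V] (hV : ∀ v : V, v + v = 0)
    (c : Finset C → V) (I : Finset C) :
    ∑ i ∈ I, ∑ j ∈ I.erase i, c ((I.erase i).erase j) = 0 := by
  rw [Finset.sum_sigma']
  apply Finset.sum_involution (fun p _ => ⟨p.2, p.1⟩)
  · rintro ⟨x, y⟩ h
    simp only [Finset.erase_right_comm (a := x) (b := y)]
    exact hV _
  · rintro ⟨x, y⟩ h _ h2
    simp at h h2
    try grind
  · rintro ⟨x, y⟩ h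
    rfl
  · rintro ⟨x, y⟩ h
    simp at h ⊢
    grind

lemma chain_add_self (v : Finset ε → ZMod 2) : v + v = 0 := by
  funext σ
  exact z2_add_self _

lemma fill {R : ε → ε → Prop} (col : ε → C)
    (hV : ∀ I : Finset C, I.Nonempty → Van R (HI col I) I.card)
    (a : Finset C → Finset ε → ZMod 2) (ha : ∀ I, Sup R (a I) (HI col I) I.card)
    (ha0 : a ∅ = 0) (hab : ∀ I, bd (a I) = ∑ i ∈ I, a (I.erase i)) :
    ∃ c : Finset C → Finset ε → ZMod 2, ∀ I, Sup R (c I) (HI col I) (I.card + 1) ∧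
      bd (c I) = a I + ∑ i ∈ I, c (I.erase i) := by
  have main : ∀ m : ℕ, ∃ c : Finset C → Finset ε → ZMod 2, ∀ I : Finset C, I.card ≤ m →
      Sup R (c I) (HI col I) (I.card + 1) ∧ bd (c I) = a I + ∑ i ∈ I, c (I.erase i) := by
    intro m
    induction m with
    | zero =>
      refine ⟨fun _ => 0, ?_⟩
      intro I hI
      have : I = ∅ := by rw [← card_eq_zero]; omega
      subst this
      refine ⟨fun σ h => absurd rfl h, ?_⟩
      rw [ha0, bd_zero]; simp
    | succ m ih =>
      obtain ⟨c, hc⟩ := ih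
      have step : ∀ I : Finset C, I.card = m + 1 → ∃ u, Sup R u (HI col I) (I.card + 1) ∧
          bd u = a I + ∑ i ∈ I, c (I.erase i) := by
        intro I hI
        apply hV I (card_pos.1 (by omega))
        · apply (ha I).add
          apply Sup.sum
          intro i hi
          have h1 : (I.erase i).card + 1 = I.card := card_erase_add_one hi
          have h2 := (hc (I.erase i) (by omega)).1
          rw [h1] at h2
          exact h2.mono (HI_mono col (erase_subset _ _))
        · rw [bd_add, bd_sum, hab]
          have h2 : ∑ i ∈ I, bd (c (I.erase i)) = ∑ i ∈ I, a (I.erase i) +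
              ∑ i ∈ I, ∑ j ∈ I.erase i, c ((I.erase i).erase j) := by
            rw [← sum_add_distrib]
            apply sum_congr rfl
            intro i hi
            have h1 : (I.erase i).card + 1 = I.card := card_erase_add_one hi
            exact (hc (I.erase i) (by omega)).2
          rw [h2, sum_sum_erase chain_add_self, add_zero]
          exact chain_add_self _
      choose! u hu using step
      refine ⟨fun I => if I.card = m + 1 then u I else c I, ?_⟩
      intro I hI
      have hs : ∑ i ∈ I, (if (I.erase i).card = m + 1 then u (I.erase i) else c (I.erase i))
          = ∑ i ∈ I, c (I.erase i) := by
        apply sum_congr rfl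
        intro i hi
        have h1 : (I.erase i).card + 1 = I.card := card_erase_add_one hi
        rw [if_neg (by omega)]
      simp only [hs]
      by_cases h : I.card = m + 1
      · rw [if_pos h]
        exact hu I h
      · rw [if_neg h]
        exact hc I (by omega)
  obtain ⟨c, hc⟩ := main (Fintype.card C)
  exact ⟨c, fun I => hc I (card_le_univ I)⟩

/-- The elementary chain. -/
def del (σ : Finset ε) : Finset ε → ZMod 2 := fun τ => if σ = τ then 1 else 0

lemma bd_del (σ : Finset ε) : bd (del σ) = ∑ x ∈ σ, del (σ.erase x) := by
  funext τ
  rw [Finset.sum_apply]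
  simp only [bd, del]
  rw [← Finset.sum_filter, ← Finset.sum_filter]
  apply Finset.sum_congr _ (fun _ _ => rfl)
  ext x
  simp only [mem_filter, mem_compl]
  constructor
  · rintro ⟨h1, rfl⟩
    exact ⟨mem_insert_self _ _, erase_insert h1⟩
  · rintro ⟨h1, rfl⟩
    exact ⟨notMem_erase _ _, (insert_erase h1).symm⟩

lemma bd_del_image {f : C → ε} (hf : Function.Injective f) (I : Finset C) :
    bd (del (I.image f)) = ∑ i ∈ I, del ((I.erase i).image f) := by
  rw [bd_del, sum_image (fun a _ b _ h => hf h)]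
  apply sum_congr rfl
  intro i _
  rw [image_erase hf]

lemma sum_swap (K : Finset ε → Prop) [DecidablePred K] (c : Finset ε → ZMod 2) :
    ∑ σ with K σ, bd c σ = ∑ τ, ((τ.filter (fun x => K (τ.erase x))).card : ZMod 2) * c τ := by
  have h1 : ∑ σ with K σ, bd c σ =
      ∑ p : ε × Finset ε, if K p.2 ∧ p.1 ∉ p.2 then c (insert p.1 p.2) else 0 := by
    rw [Fintype.sum_prod_type_right, sum_filter]
    apply sum_congr rfl
    intro σ _
    by_cases h : K σ
    · simp only [h, if_true, true_and, bd]
      rw [← sum_filter]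
      apply sum_congr _ (fun _ _ => rfl)
      ext x; simp
    · simp [h]
  have h2 : ∑ τ, ((τ.filter (fun x => K (τ.erase x))).card : ZMod 2) * c τ =
      ∑ p : ε × Finset ε, if p.1 ∈ p.2 ∧ K (p.2.erase p.1) then c p.2 else 0 := by
    rw [Fintype.sum_prod_type_right]
    apply sum_congr rfl
    intro τ _
    have h3 : ∑ x : ε, (if x ∈ τ ∧ K (τ.erase x) then c τ else 0) =
        ((τ.filter (fun x => K (τ.erase x))).card : ZMod 2) * c τ := by
      rw [← sum_filter, sum_const, nsmul_eq_mul]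
      congr 3
      ext x; simp
    exact h3.symm
  rw [h1, h2, ← sum_filter, ← sum_filter]
  refine sum_bij' (fun p _ => (p.1, insert p.1 p.2)) (fun p _ => (p.1, p.2.erase p.1))
    ?_ ?_ ?_ ?_ ?_
  · rintro ⟨x, σ⟩ h
    simp only [mem_filter, mem_univ, true_and] at h ⊢
    exact ⟨mem_insert_self _ _, by rw [erase_insert h.2]; exact h.1⟩
  · rintro ⟨x, σ⟩ h
    simp only [mem_filter, mem_univ, true_and] at h ⊢
    exact ⟨h.2, notMem_erase _ _⟩
  · rintro ⟨x, σ⟩ h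
    simp only [mem_filter, mem_univ, true_and] at h ⊢
    rw [erase_insert h.2]
  · rintro ⟨x, σ⟩ h
    simp only [mem_filter, mem_univ, true_and] at h ⊢
    rw [insert_erase h.1]
  · rintro ⟨x, σ⟩ h
    rfl

lemma sum_del (K : Finset ε → Prop) [DecidablePred K] (A : Finset ε) :
    ∑ σ with K σ, del A σ = if K A then 1 else 0 := by
  simp [del, sum_filter, ← ite_and, sum_ite_eq]

lemma exists_color {col : ε → C} {σ : Finset ε} (h : Set.InjOn col σ)
    (hc : σ.card = Fintype.card C) (i : C) : ∃ x ∈ σ, col x = i := by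
  have h1 : (σ.image col) = univ := by
    rw [← card_eq_iff_eq_univ, card_image_of_injOn h, hc]
  have := mem_univ i
  rw [← h1] at this
  exact mem_image.1 this

lemma sperner {R : ε → ε → Prop} (col : ε → C)
    (hV : ∀ I : Finset C, I.Nonempty → Van R (HI col I) I.card)
    (f g : C → ε) (hf : ∀ i, col (f i) = i) (hg : ∀ i, col (g i) = i)
    (hfI : Ind R (univ.image f)) (hgI : Ind R (univ.image g))
    (K : Finset ε → Prop) (hK : ∀ σ, K σ → Set.InjOn col σ ∧ σ.card = Fintype.card C)
    (hstep : ∀ τ x y, Ind R τ → τ.card = Fintype.card C + 1 → x ∈ τ → y ∈ τ → x ≠ y →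
      col x = col y → K (τ.erase x) → K (τ.erase y))
    (hKf : K (univ.image f)) : K (univ.image g) := by
  classical
  have hfi : Function.Injective f := fun a b h => by rw [← hf a, ← hf b, h]
  have hgi : Function.Injective g := fun a b h => by rw [← hg a, ← hg b, h]
  have supdel : ∀ (f : C → ε), (∀ i, col (f i) = i) → Function.Injective f →
      Ind R (univ.image f) → ∀ I : Finset C, Sup R (del (I.image f)) (HI col I) I.card := by
    intro f hf hfi hfI I σ h
    simp only [del] at h
    split_ifs at h with h1
    · subst h1
      refine ⟨?_, hfI.subset (image_subset_image (subset_univ _)), card_image_of_injective _ hfi⟩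
      intro e he
      obtain ⟨i, hi, rfl⟩ := mem_image.1 he
      simp [HI, hf, hi]
    · exact absurd rfl h
  obtain ⟨c, hc⟩ := fill col hV (fun I => del (I.image f) + del (I.image g))
    (fun I => (supdel f hf hfi hfI I).add (supdel g hg hgi hgI I))
    (by simp only [image_empty]; exact chain_add_self _)
    (fun I => by rw [bd_add, bd_del_image hfi, bd_del_image hgi, sum_add_distrib])
  obtain ⟨hcS, hcb⟩ := hc univ
  have hzero : ∑ σ with K σ, bd (c univ) σ = 0 := by
    rw [sum_swap]
    apply sum_eq_zero
    intro τ _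
    by_cases hτ : c univ τ = 0
    · rw [hτ, mul_zero]
    obtain ⟨-, hI, hcard⟩ := hcS τ hτ
    rw [card_univ] at hcard
    rcases (τ.filter (fun x => K (τ.erase x))).eq_empty_or_nonempty with h0 | ⟨x, hx⟩
    · rw [h0]; simp
    simp only [mem_filter] at hx
    obtain ⟨hxτ, hxK⟩ := hx
    obtain ⟨hinj, hcd⟩ := hK _ hxK
    obtain ⟨y, hy, hyx⟩ := exists_color hinj hcd (col x)
    rw [mem_erase] at hy
    have hyK := hstep τ x y hI hcard hxτ hy.2 hy.1.symm hyx.symm hxK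
    have hset : τ.filter (fun x => K (τ.erase x)) = {x, y} := by
      ext z
      simp only [mem_filter, mem_insert, mem_singleton]
      constructor
      · rintro ⟨hz, hzK⟩
        by_contra hne
        push Not at hne
        have h1 := (hK _ hzK).1 
          (mem_coe.2 (mem_erase.2 ⟨hne.1.symm, hxτ⟩))
          (mem_coe.2 (mem_erase.2 ⟨hne.2.symm, hy.2⟩)) hyx.symm
        exact hy.1 h1.symm
      · rintro (rfl | rfl)
        · exact ⟨hxτ, hxK⟩
        · exact ⟨hy.2, hyK⟩
    rw [hset, card_pair hy.1.symm]
    have : ((2 : ℕ) : ZMod 2) = 0 := by decide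
    rw [this, zero_mul]
  rw [hcb] at hzero
  simp only [Pi.add_apply, sum_add_distrib] at hzero
  have h3 : ∑ σ with K σ, (∑ i ∈ univ, c (univ.erase i)) σ = 0 := by
    apply sum_eq_zero
    intro σ hσ
    simp only [mem_filter, mem_univ, true_and] at hσ
    rw [Finset.sum_apply]
    apply sum_eq_zero
    intro i _
    by_contra h
    have h1 := ((hc (univ.erase i)).1 σ h).1
    obtain ⟨x, hx, hxi⟩ := exists_color (hK σ hσ).1 (hK σ hσ).2 i
    have := h1 hx
    simp [HI, hxi] at this
  rw [h3, add_zero] at hzero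
  by_contra hcon
  rw [sum_del, sum_del, if_pos hKf, if_neg hcon] at hzero
  exact absurd hzero (by decide)

end RMC
namespace RMC

/-- Left endpoint, with dummy elements. -/
def lE (n d : ℕ) : (Fin n × Fin n) ⊕ (Fin d × Fin n) → Fin n ⊕ (Fin d ⊕ (Fin d × Fin n))
  | Sum.inl e => Sum.inl e.1
  | Sum.inr p => Sum.inr (Sum.inl p.1)

/-- Right endpoint, with dummy elements. -/
def rE (n d : ℕ) : (Fin n × Fin n) ⊕ (Fin d × Fin n) → Fin n ⊕ (Fin d ⊕ (Fin d × Fin n))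
  | Sum.inl e => Sum.inl e.2
  | Sum.inr p => Sum.inr (Sum.inr p)

/-- Colour, with dummy elements. -/
def colE {n : ℕ} (d : ℕ) (c0 : Fin n × Fin n → Fin n) :
    (Fin n × Fin n) ⊕ (Fin d × Fin n) → Fin n
  | Sum.inl e => c0 e
  | Sum.inr p => p.2

lemma hinjE (n d : ℕ) (e f : (Fin n × Fin n) ⊕ (Fin d × Fin n))
    (h1 : lE n d e = lE n d f) (h2 : rE n d e = rE n d f) : e = f := by
  rcases e with ⟨a, b⟩ | ⟨a, b⟩ <;> rcases f with ⟨a', b'⟩ | ⟨a', b'⟩ <;>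
    simp_all [lE, rE]

/-- Real elements with colours in `I` and dummies in `D × I`. -/
def HD {n d : ℕ} (c0 : Fin n × Fin n → Fin n) (I : Finset (Fin n)) (D : Finset (Fin d)) :
    Finset ((Fin n × Fin n) ⊕ (Fin d × Fin n)) :=
  (univ.filter (fun e => c0 e ∈ I)).disjSum (D ×ˢ I)

lemma van_base {n d k : ℕ} (hn : 1 ≤ n) (hk : 3 * (k + 1) ≤ 2 * n + 1) (hd : d + k = n)
    (c0 : Fin n × Fin n → Fin n) (hc : ∀ i, (univ.filter (fun e => c0 e = i)).card = n)
    (I : Finset (Fin n)) (hI : d ≤ I.card) :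
    Van (Rl (lE n d) (rE n d)) (HD c0 I (∅ : Finset (Fin d))) (I.card - d) := by
  have hcard : (HD c0 I (∅ : Finset (Fin d))).card = n * I.card := by
    simp only [HD, empty_product, card_disjSum, card_empty, add_zero]
    rw [card_eq_sum_card_fiberwise (f := c0) (t := I)]
    · rw [sum_const_nat (m := n), mul_comm]
      intro i hi
      refine Eq.trans ?_ (hc i)
      congr 1
      ext e
      simp only [mem_filter, mem_univ, true_and]
      constructor
      · exact fun h => h.2
      · rintro rfl; exact ⟨hi, rfl⟩
    · intro e he
      simpa using he
  have hsub : ∀ (q : (Fin n × Fin n) ⊕ (Fin d × Fin n) → Fin n ⊕ (Fin d ⊕ (Fin d × Fin n))),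
      (∀ e, ∃ a, q (Sum.inl e) = Sum.inl a) →
      ((HD c0 I (∅ : Finset (Fin d))).image q).card ≤ n := by
    intro q hq
    calc _ ≤ ((univ : Finset (Fin n)).image
          (Sum.inl : Fin n → Fin n ⊕ (Fin d ⊕ (Fin d × Fin n)))).card := by
          apply card_le_card
          intro v hv
          obtain ⟨e, he, rfl⟩ := mem_image.1 hv
          rcases e with e | e
          · obtain ⟨a, ha⟩ := hq e
            rw [ha]; simp
          · simp [HD] at he
      _ ≤ _ := card_image_le.trans (by simp)
  refine claim_all _ (n + n) (lE n d) (rE n d) (hinjE n d) _ n n rfl (by omega) (by omega)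
    (by omega) (hsub _ fun e => ⟨_, rfl⟩) (hsub _ fun e => ⟨_, rfl⟩) ?_
  rw [hcard]
  have h3 : (((I.card - d : ℕ)) : ℤ) = I.card - d := by push_cast [hI]; rfl
  rw [h3]
  have hd' : (d : ℤ) = n - k := by omega
  rw [hd']
  push_cast
  have hk' : (3 * (k + 1) : ℤ) ≤ 2 * n + 1 := by exact_mod_cast hk
  nlinarith [mul_le_mul_of_nonneg_left hk' (show (0 : ℤ) ≤ 2 * n by positivity)]

lemma van_HD {n d : ℕ} (c0 : Fin n × Fin n → Fin n) (I : Finset (Fin n)) (hI : I.Nonempty)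
    (D : Finset (Fin d)) : ∀ t : ℕ,
    (D.card ≤ t → Van (Rl (lE n d) (rE n d)) (HD c0 I (∅ : Finset (Fin d))) (t - D.card)) →
    Van (Rl (lE n d) (rE n d)) (HD c0 I D) t := by
  obtain ⟨i0, hi0⟩ := hI
  induction D using Finset.induction_on with
  | empty =>
    intro t h
    simpa using h
  | insert j D hj ih =>
    intro t h
    have hmem : (Sum.inr (j, i0) : (Fin n × Fin n) ⊕ (Fin d × Fin n)) ∈
        HD c0 I (insert j D) := by
      simp [HD, hi0]
    rcases t with _ | t
    · exact van_zero ⟨_, hmem⟩ _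
    · apply explode_lr (hinjE n d) hmem
      · intro g hg hne hr
        exfalso
        rcases g with g | g
        · simp [rE] at hr
        · simp only [rE, Sum.inr.injEq] at hr
          exact hne (by rw [hr])
      · intro g hg hne hl
        rcases g with g | ⟨j', i⟩
        · simp [lE] at hl
        simp only [lE, Sum.inr.injEq, Sum.inl.injEq] at hl
        subst hl
        have hset : (HD c0 I (insert j' D)).filter (fun e =>
            ¬ Rl (lE n d) (rE n d) (Sum.inr (j', i)) e ∧
            ¬ Rl (lE n d) (rE n d) (Sum.inr (j', i0)) e) = HD c0 I D := by
          ext e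
          rcases e with e | ⟨a, b⟩
          · rw [mem_filter]; simp [HD, Rl, lE, rE]
          · rw [mem_filter]
            simp only [HD, Rl, lE, rE, inr_mem_disjSum, mem_product, mem_insert,
              Sum.inr.injEq, Sum.inl.injEq, Prod.mk.injEq]
            grind
        convert ih t ?_ using 1
        intro hD
        have := h (by rw [card_insert_of_notMem hj]; omega)
        rw [card_insert_of_notMem hj] at this
        convert this using 1
        omega

lemma van_HI {n d k : ℕ} (hn : 1 ≤ n) (hk : 3 * (k + 1) ≤ 2 * n + 1) (hd : d + k = n)
    (c0 : Fin n × Fin n → Fin n) (hc : ∀ i, (univ.filter (fun e => c0 e = i)).card = n)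
    (I : Finset (Fin n)) (hI : I.Nonempty) :
    Van (Rl (lE n d) (rE n d)) (HI (colE d c0) I) I.card := by
  have hset : HI (colE d c0) I = HD c0 I univ := by
    ext e
    rw [HI, mem_filter]
    rcases e with e | e <;> simp [HD, colE]
  rw [hset]
  apply van_HD c0 I hI
  rw [card_univ, Fintype.card_fin]
  exact van_base hn hk hd c0 hc I

lemma rainbow_of_ind {n d k : ℕ} (Ep : Fin n → Finset (Fin n × Fin n))
    (c0 : Fin n × Fin n → Fin n) (hc0 : ∀ e i, e ∈ Ep i ↔ c0 e = i)
    (σ : Finset ((Fin n × Fin n) ⊕ (Fin d × Fin n))) (hI : Ind (Rl (lE n d) (rE n d)) σ)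
    (hr : Set.InjOn (colE d c0) σ) (S : Finset (Fin n × Fin n)) (hS : ∀ e ∈ S, Sum.inl e ∈ σ)
    (hSk : S.card = k) : IsRainbowMatching Ep k S := by
  refine ⟨?_, hSk, ?_⟩
  · intro e he f hf hne
    constructor
    · intro h
      have := hI _ (hS e he) _ (hS f hf) (Or.inl (by simp [lE, h]))
      exact hne (Sum.inl_injective this)
    · intro h
      have := hI _ (hS e he) _ (hS f hf) (Or.inr (by simp [rE, h]))
      exact hne (Sum.inl_injective this)
  · intro i
    rw [card_le_one]
    intro e he f hf
    simp only [mem_inter, hc0] at he hf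
    have := hr (mem_coe.2 (hS e he.1)) (mem_coe.2 (hS f hf.1))
      (by simp only [colE]; rw [he.2, hf.2])
    exact Sum.inl_injective this

lemma matching_of_ind {n d : ℕ}
    (σ : Finset ((Fin n × Fin n) ⊕ (Fin d × Fin n))) (hI : Ind (Rl (lE n d) (rE n d)) σ)
    (S : Finset (Fin n × Fin n)) (hS : ∀ e ∈ S, Sum.inl e ∈ σ) : KnnMatching S := by
  intro e he f hf hne
  constructor
  · intro h
    have := hI _ (hS e he) _ (hS f hf) (Or.inl (by simp [lE, h]))
    exact hne (Sum.inl_injective this)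
  · intro h
    have := hI _ (hS e he) _ (hS f hf) (Or.inr (by simp [rE, h]))
    exact hne (Sum.inl_injective this)

lemma left_card {n d k : ℕ} (hd : d + k = n)
    (σ : Finset ((Fin n × Fin n) ⊕ (Fin d × Fin n))) (hI : Ind (Rl (lE n d) (rE n d)) σ)
    (hcard : σ.card = n) : k ≤ σ.toLeft.card := by
  have h1 : σ.toRight.card ≤ d := by
    have h2 : σ.toRight.card ≤ (univ : Finset (Fin d)).card := by
      apply card_le_card_of_injOn Prod.fst (fun _ _ => mem_univ _)
      intro p hp q hq h
      have := hI _ (mem_toRight.1 (mem_coe.1 hp)) _ (mem_toRight.1 (mem_coe.1 hq))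
        (Or.inl (by simp only [lE]; rw [h]))
      exact Sum.inr_injective this
    simpa using h2
  have h3 := card_toLeft_add_card_toRight (u := σ)
  omega

/-- The predicate propagated along the reconfiguration. -/
def KP {n d : ℕ} (Ep : Fin n → Finset (Fin n × Fin n)) (k : ℕ) (c0 : Fin n × Fin n → Fin n)
    (M : Finset (Fin n × Fin n)) (σ : Finset ((Fin n × Fin n) ⊕ (Fin d × Fin n))) : Prop :=
  Ind (Rl (lE n d) (rE n d)) σ ∧ Set.InjOn (colE d c0) σ ∧ σ.card = n ∧
    ∀ S : Finset (Fin n × Fin n), (∀ e ∈ S, Sum.inl e ∈ σ) → S.card = k →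
      Relation.ReflTransGen (RMAdj Ep k) M S

lemma KP_step {n d k : ℕ} (hd : d + k = n) (Ep : Fin n → Finset (Fin n × Fin n))
    (c0 : Fin n × Fin n → Fin n) (hc0 : ∀ e i, e ∈ Ep i ↔ c0 e = i)
    (M : Finset (Fin n × Fin n)) (τ : Finset ((Fin n × Fin n) ⊕ (Fin d × Fin n)))
    (x y : (Fin n × Fin n) ⊕ (Fin d × Fin n)) (hI : Ind (Rl (lE n d) (rE n d)) τ)
    (hcard : τ.card = n + 1) (hx : x ∈ τ) (hy : y ∈ τ) (hxy : x ≠ y)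
    (hcol : colE d c0 x = colE d c0 y) (hK : KP Ep k c0 M (τ.erase x)) :
    KP Ep k c0 M (τ.erase y) := by
  obtain ⟨hI1, hr1, hc1, hS1⟩ := hK
  have hI2 : Ind (Rl (lE n d) (rE n d)) (τ.erase y) := hI.subset (erase_subset _ _)
  have hr2 : Set.InjOn (colE d c0) (τ.erase y : Finset _) := by
    intro a ha b hb hab
    rw [mem_coe, mem_erase] at ha hb
    have hr : ∀ a b, a ≠ x → a ∈ τ → b ≠ x → b ∈ τ → colE d c0 a = colE d c0 b → a = b :=
      fun a b h1 h2 h3 h4 h5 => hr1 (mem_coe.2 (mem_erase.2 ⟨h1, h2⟩))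
        (mem_coe.2 (mem_erase.2 ⟨h3, h4⟩)) h5
    by_cases hax : a = x
    · by_cases hbx : b = x
      · rw [hax, hbx]
      · subst hax
        exact absurd (hr b y hbx hb.2 hxy.symm hy (by rw [← hab, hcol])) hb.1
    · by_cases hbx : b = x
      · subst hbx
        exact absurd (hr a y hax ha.2 hxy.symm hy (by rw [hab, hcol])) ha.1
      · exact hr a b hax ha.2 hbx hb.2 hab
  refine ⟨hI2, hr2, by rw [card_erase_of_mem hy]; omega, ?_⟩
  intro S' hS' hk'
  by_cases hall : ∀ e ∈ S', Sum.inl e ∈ τ.erase x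
  · exact hS1 S' hall hk'
  push Not at hall
  obtain ⟨x0, hx0, hx0'⟩ := hall
  have hx0τ : Sum.inl x0 ∈ τ := mem_of_mem_erase (hS' x0 hx0)
  have hxe : x = Sum.inl x0 := by
    by_contra h
    exact hx0' (mem_erase.2 ⟨fun h' => h h'.symm, hx0τ⟩)
  have hlc := left_card hd _ hI1 hc1
  have hlt : (S'.erase x0).card < (τ.erase x).toLeft.card := by
    have := card_erase_add_one hx0
    omega
  obtain ⟨z, hz, hzS⟩ := exists_mem_notMem_of_card_lt_card hlt
  rw [mem_toLeft] at hz
  have hzx : z ≠ x0 := by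
    rintro rfl
    rw [hxe] at hz
    exact notMem_erase _ _ hz
  have hzS' : z ∉ S' := fun h => hzS (mem_erase.2 ⟨hzx, h⟩)
  have hScard : (insert z (S'.erase x0)).card = k := by
    rw [card_insert_of_notMem hzS, card_erase_add_one hx0, hk']
  have hSσ : ∀ e ∈ insert z (S'.erase x0), Sum.inl e ∈ τ.erase x := by
    intro e he
    rcases mem_insert.1 he with rfl | he
    · exact hz
    · rw [mem_erase] at he
      refine mem_erase.2 ⟨?_, mem_of_mem_erase (hS' e he.2)⟩
      rw [hxe]
      exact fun h => he.1 (Sum.inl_injective h)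
  have hun : insert z (S'.erase x0) ∪ S' = insert z S' := by
    rw [insert_union, union_eq_right.2 (erase_subset _ _)]
  refine (hS1 _ hSσ hScard).tail ⟨?_, ?_, ?_, ?_⟩
  · exact rainbow_of_ind Ep c0 hc0 _ hI1 hr1 _ hSσ hScard
  · exact rainbow_of_ind Ep c0 hc0 _ hI2 hr2 _ hS' hk'
  · rw [hun]
    apply matching_of_ind τ hI
    intro e he
    rcases mem_insert.1 he with rfl | he
    · exact mem_of_mem_erase hz
    · exact mem_of_mem_erase (hS' e he)
  · rw [hun, card_insert_of_notMem hzS', hk']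

lemma exists_section {n d k : ℕ} (hd : d + k = n) (Ep : Fin n → Finset (Fin n × Fin n))
    (c0 : Fin n × Fin n → Fin n) (hc0 : ∀ e i, e ∈ Ep i ↔ c0 e = i)
    (M : Finset (Fin n × Fin n)) (hM : IsRainbowMatching Ep k M) :
    ∃ f : Fin n → (Fin n × Fin n) ⊕ (Fin d × Fin n), (∀ i, colE d c0 (f i) = i) ∧
      Ind (Rl (lE n d) (rE n d)) (univ.image f) ∧
      ∀ e, Sum.inl e ∈ univ.image f ↔ e ∈ M := by
  classical
  obtain ⟨hmat, hcard, hrain⟩ := hM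
  have hinj : Set.InjOn c0 M := by
    intro a ha b hb hab
    exact card_le_one.1 (hrain (c0 b)) a (mem_inter.2 ⟨ha, (hc0 _ _).2 hab⟩) b
      (mem_inter.2 ⟨hb, (hc0 _ _).2 rfl⟩)
  have hcc : ((M.image c0)ᶜ).card = d := by
    rw [card_compl, card_image_of_injOn hinj, hcard, Fintype.card_fin]; omega
  let φ := (M.image c0)ᶜ.equivFinOfCardEq hcc
  have key : ∀ i : Fin n, ∃ v : (Fin n × Fin n) ⊕ (Fin d × Fin n),
      (∃ e ∈ M, c0 e = i ∧ v = Sum.inl e) ∨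
      (∃ h : i ∈ (M.image c0)ᶜ, v = Sum.inr (φ ⟨i, h⟩, i)) := by
    intro i
    by_cases h : i ∈ (M.image c0)ᶜ
    · exact ⟨_, Or.inr ⟨h, rfl⟩⟩
    · rw [mem_compl, not_not] at h
      obtain ⟨e, he, hi⟩ := mem_image.1 h
      exact ⟨_, Or.inl ⟨e, he, hi, rfl⟩⟩
  choose f hf using key
  have hcol : ∀ i, colE d c0 (f i) = i := by
    intro i
    rcases hf i with ⟨e, he, hi, h⟩ | ⟨h', h⟩
    · rw [h]; exact hi
    · rw [h]; rfl
  refine ⟨f, hcol, ?_, ?_⟩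
  · intro a ha b hb hab
    obtain ⟨i, -, rfl⟩ := mem_image.1 ha
    obtain ⟨j, -, rfl⟩ := mem_image.1 hb
    rcases hf i with ⟨e, he, hi, h⟩ | ⟨h', h⟩ <;>
    rcases hf j with ⟨e2, he2, hj, h2⟩ | ⟨h2', h2⟩ <;> rw [h, h2] at hab ⊢
    · by_cases hee : e = e2
      · rw [hee]
      · have := hmat e he e2 he2 hee
        simp only [Rl, lE, rE, Sum.inl.injEq] at hab
        rcases hab with hab | hab
        · exact absurd hab this.1
        · exact absurd hab this.2
    · simp [Rl, lE, rE] at hab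
    · simp [Rl, lE, rE] at hab
    · have hij : i = j := by
        rcases hab with hab | hab
        · simp only [lE, Sum.inr.injEq, Sum.inl.injEq] at hab
          have := φ.injective hab
          exact congrArg Subtype.val this
        · simp only [rE, Sum.inr.injEq, Prod.mk.injEq] at hab
          exact hab.2
      subst hij
      rfl
  · intro e
    constructor
    · intro he
      obtain ⟨i, -, hi⟩ := mem_image.1 he
      rcases hf i with ⟨e2, he2, -, h⟩ | ⟨h', h⟩
      · rw [h] at hi
        rw [← Sum.inl_injective hi]; exact he2
      · rw [h] at hi
        cases hi
    · intro he
      refine mem_image.2 ⟨c0 e, mem_univ _, ?_⟩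
      rcases hf (c0 e) with ⟨e2, he2, hee, h⟩ | ⟨h', h⟩
      · rw [h, hinj he2 he hee]
      · rw [mem_compl] at h'
        exact absurd (mem_image_of_mem c0 he) h'

lemma k_arith {n k : ℕ} (hn : 1 ≤ n) (hk : k = (⌈2 * (n : ℚ) / 3 - 3 / 2⌉).toNat) :
    3 * (k + 1) ≤ 2 * n + 1 := by
  have h1 : ⌈2 * (n : ℚ) / 3 - 3 / 2⌉ ≤ (((2 * n + 1) / 3 - 1 : ℕ) : ℤ) := by
    rw [Int.ceil_le]
    have h2 : 2 * n ≤ 3 * ((2 * n + 1) / 3 - 1) + 4 := by omega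
    have h3 : (2 * n : ℚ) ≤ 3 * (((2 * n + 1) / 3 - 1 : ℕ) : ℚ) + 4 := by exact_mod_cast h2
    push_cast at h3 ⊢
    linarith
  omega

end RMC

end RMCHelpers

/-- If `𝓔` is a partition of the edge set of `K_{n,n}` into `n` classes each of size
`n`, then for `k = ⌈2n/3 − 3/2⌉` the reconfiguration graph on rainbow matchings of
size `k` is connected. -/
theorem stmt_10 (n : ℕ) (hn : 1 ≤ n)
    (Ep : Fin n → Finset (Fin n × Fin n))
    (hdisj : ∀ i j, i ≠ j → Disjoint (Ep i) (Ep j))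
    (hcover : Finset.univ.biUnion Ep = Finset.univ)
    (hsize : ∀ i, (Ep i).card = n)
    (k : ℕ) (hk : k = (⌈2 * (n : ℚ) / 3 - 3 / 2⌉).toNat)
    (M M' : Finset (Fin n × Fin n))
    (hM : IsRainbowMatching Ep k M) (hM' : IsRainbowMatching Ep k M') :
    Relation.ReflTransGen (RMAdj Ep k) M M' := by
  have hk3 := RMC.k_arith hn hk
  obtain ⟨d, hd⟩ : ∃ d, d + k = n := ⟨n - k, by omega⟩
  have hex : ∀ e : Fin n × Fin n, ∃ i, e ∈ Ep i := by
    intro e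
    have h : e ∈ Finset.univ.biUnion Ep := by rw [hcover]; exact Finset.mem_univ e
    obtain ⟨i, -, hi⟩ := Finset.mem_biUnion.1 h
    exact ⟨i, hi⟩
  choose c0 hc using hex
  have hc0 : ∀ e i, e ∈ Ep i ↔ c0 e = i := by
    intro e i
    constructor
    · intro h
      by_contra hne
      exact Finset.disjoint_left.1 (hdisj _ _ hne) (hc e) h
    · rintro rfl
      exact hc e
  have hcc : ∀ i, (Finset.univ.filter (fun e => c0 e = i)).card = n := by
    intro i
    refine Eq.trans ?_ (hsize i)
    congr 1
    ext e
    simp [hc0]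
  obtain ⟨f, hf, hfI, hfM⟩ := RMC.exists_section hd Ep c0 hc0 M hM
  obtain ⟨g, hg, hgI, hgM⟩ := RMC.exists_section hd Ep c0 hc0 M' hM'
  have hfin : RMC.KP Ep k c0 M (Finset.univ.image f) := by
    refine ⟨hfI, ?_, ?_, ?_⟩
    · intro a ha b hb hab
      obtain ⟨i, -, rfl⟩ := Finset.mem_image.1 (Finset.mem_coe.1 ha)
      obtain ⟨j, -, rfl⟩ := Finset.mem_image.1 (Finset.mem_coe.1 hb)
      rw [hf, hf] at hab
      rw [hab]
    · rw [Finset.card_image_of_injective _ (fun a b h => by rw [← hf a, ← hf b, h])]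
      simp
    · intro S hS hSk
      have hSM : S ⊆ M := fun e he => (hfM e).1 (hS e he)
      have : S = M := Finset.eq_of_subset_of_card_le hSM (by rw [hSk, hM.2.1])
      rw [this]
  have := RMC.sperner (RMC.colE d c0) (RMC.van_HI hn hk3 hd c0 hcc) f g hf hg hfI hgI
    (RMC.KP Ep k c0 M)
    (fun σ h => ⟨h.2.1, by rw [Fintype.card_fin]; exact h.2.2.1⟩)
    (fun τ x y hI hcard hx hy hxy hcol hK =>
      RMC.KP_step hd Ep c0 hc0 M τ x y hI (by rw [hcard, Fintype.card_fin]) hx hy hxy hcol hK)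
    hfin
  exact this.2.2.2 M' (fun e he => (hgM e).2 he) hM'.2.1
end

section
/- Let H be a bipartite r-uniform hypergraph with bipartition (A, B). If ν(lk_H(X)) ≥ (r − 1)|X| + 1 for every nonempty subset X ⊆ A, then the reconfiguration graph RG_Mat(H, A) on matchings of size |A| is connected. -/
/-- Adjacency in the reconfiguration graph `RG_Mat(H, A; k)` of a bipartite hypergraph
with bipartition `(A, B)`: two matchings of size `k` are adjacent if their symmetric
difference consists of exactly two edges whose parts on the `B`-side are disjoint. -/
def BipMatAdj {V : Type*} [DecidableEq V] (E : Finset (Finset V)) (B : Finset V)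
    (k : ℕ) (M M' : Finset (Finset V)) : Prop :=
  HypMatching E M ∧ HypMatching E M' ∧ M.card = k ∧ M'.card = k ∧
    ∃ e f : Finset V, M \ M' = {e} ∧ M' \ M = {f} ∧ Disjoint (e ∩ B) (f ∩ B)

namespace RGProof

set_option linter.unusedSectionVars false

open Finset

theorem symm_sum {W M : Type*} [DecidableEq W] [AddCommMonoid M] (h2 : ∀ a : M, a + a = 0)
    (X : Finset W) (g : W → W → M) (hg : ∀ x y, g x y = g y x) :
    ∑ x ∈ X, ∑ y ∈ X.erase x, g x y = 0 := by
  rw [Finset.sum_sigma']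
  classical
  refine Finset.sum_involution (fun p _ => ⟨p.2, p.1⟩) ?_ ?_ ?_ ?_
  · rintro ⟨x, y⟩ h
    simp only
    rw [hg y x, h2]
  · rintro ⟨x, y⟩ h hne heq
    simp only [Sigma.mk.injEq, heq_eq_eq] at heq
    simp [heq.1] at h
  · rintro ⟨x, y⟩ h
    simp only [mem_sigma, mem_erase] at h ⊢
    exact ⟨h.2.2, h.2.1.symm, h.1⟩
  · rintro ⟨x, y⟩ h
    rfl

variable {W : Type*} [Fintype W] [DecidableEq W]

theorem two_zero (a : Finset W → ZMod 2) : a + a = 0 := by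
  funext σ
  exact CharTwo.add_self_eq_zero _

/-- mod 2 boundary -/
def bd (z : Finset W → ZMod 2) : Finset W → ZMod 2 := fun τ => ∑ x ∈ τᶜ, z (insert x τ)

/-- cone operator -/
def cone (f : W) (z : Finset W → ZMod 2) : Finset W → ZMod 2 :=
  fun σ => if f ∈ σ then z (σ.erase f) else 0

/-- supported on simplices with `j` vertices in `S` -/
def Supp (R : W → W → Prop) (S : Finset W) (j : ℕ) (z : Finset W → ZMod 2) : Prop :=
  ∀ σ, z σ ≠ 0 → σ ⊆ S ∧ σ.card = j ∧ (σ : Set W).Pairwise R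

theorem bd_add (z w : Finset W → ZMod 2) : bd (z + w) = bd z + bd w := by
  funext τ
  simp [bd, Finset.sum_add_distrib]

theorem bd_zero : bd (0 : Finset W → ZMod 2) = 0 := by
  funext τ
  simp [bd]

theorem bd_sum {ι : Type*} (s : Finset ι) (z : ι → Finset W → ZMod 2) :
    bd (∑ i ∈ s, z i) = ∑ i ∈ s, bd (z i) := by
  classical
  induction s using Finset.induction_on with
  | empty => simp [bd_zero]
  | insert a s ha ih => rw [Finset.sum_insert ha, Finset.sum_insert ha, bd_add, ih]

theorem bd_bd (z : Finset W → ZMod 2) : bd (bd z) = 0 := by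
  funext τ
  simp only [bd, Finset.compl_insert, Pi.zero_apply]
  refine symm_sum (fun a => CharTwo.add_self_eq_zero a) τᶜ
    (fun x y => z (insert y (insert x τ))) ?_
  intro x y
  rw [Finset.insert_comm]

theorem bd_cone (f : W) (z : Finset W → ZMod 2) : bd (cone f z) = z + cone f (bd z) := by
  funext τ
  simp only [bd, cone, Pi.add_apply]
  by_cases hf : f ∈ τ
  · have h1 : (τ.erase f)ᶜ = insert f τᶜ := Finset.compl_erase
    simp only [hf, if_true, mem_insert, or_true, h1]
    rw [Finset.sum_insert (by simpa using hf), Finset.insert_erase hf, ← add_assoc,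
      CharTwo.add_self_eq_zero, zero_add]
    refine Finset.sum_congr rfl fun x hx => ?_
    have hx' : x ≠ f := by
      rintro rfl
      exact (Finset.mem_compl.1 hx) hf
    rw [Finset.erase_insert_of_ne hx']
  · simp only [hf, if_false, mem_insert, or_false, add_zero]
    rw [Finset.sum_eq_single f]
    · simp [hf]
    · intro b _ hb
      simp [hb.symm]
    · intro h
      simp [hf] at h

theorem bd_adj (ψ c : Finset W → ZMod 2) :
    ∑ σ, ψ σ * bd c σ = ∑ τ, (∑ x ∈ τ, ψ (τ.erase x)) * c τ := by
  simp only [bd, Finset.mul_sum, Finset.sum_mul]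
  rw [Finset.sum_sigma', Finset.sum_sigma']
  refine Finset.sum_bij' (fun p _ => ⟨insert p.2 p.1, p.2⟩) (fun p _ => ⟨p.1.erase p.2, p.2⟩)
    ?_ ?_ ?_ ?_ ?_
  · rintro ⟨σ, x⟩ h
    simp
  · rintro ⟨σ, x⟩ h
    simp
  · rintro ⟨σ, x⟩ h
    simp at h
    simp [h]
  · rintro ⟨σ, x⟩ h
    simp at h
    simp [h]
  · rintro ⟨σ, x⟩ h
    simp at h
    simp [h]

theorem bd_single (σ : Finset W) :
    bd (Pi.single σ 1) = ∑ x ∈ σ, (Pi.single (σ.erase x) 1 : Finset W → ZMod 2) := by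
  funext τ
  have := bd_adj (Pi.single τ 1) (Pi.single σ 1)
  rw [Finset.sum_eq_single τ, Finset.sum_eq_single σ] at this
  · simp only [Pi.single_eq_same, one_mul, mul_one] at this
    rw [this, Finset.sum_apply]
    refine Finset.sum_congr rfl fun x _ => ?_
    simp only [Pi.single_apply, eq_comm]
  · intro b _ hb
    simp [Pi.single_apply, hb]
  · simp
  · intro b _ hb
    simp [Pi.single_apply, hb]
  · simp

variable {R : W → W → Prop}

theorem Supp.add {S : Finset W} {j : ℕ} {z w : Finset W → ZMod 2} (hz : Supp R S j z)
    (hw : Supp R S j w) : Supp R S j (z + w) := by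
  intro σ h
  by_cases h1 : z σ = 0
  · refine hw σ fun h2 => h ?_
    simp [h1, h2]
  · exact hz σ h1

theorem Supp.zero {S : Finset W} {j : ℕ} : Supp R S j 0 := by
  intro σ h
  simp at h

theorem Supp.sum {ι : Type*} {S : Finset W} {j : ℕ} (s : Finset ι)
    (z : ι → Finset W → ZMod 2) (hz : ∀ i ∈ s, Supp R S j (z i)) :
    Supp R S j (∑ i ∈ s, z i) := by
  classical
  induction s using Finset.induction_on with
  | empty => exact Supp.zero
  | insert a s ha ih =>
    rw [Finset.sum_insert ha]
    exact (hz a (by simp)).add (ih fun i hi => hz i (by simp [hi]))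

theorem Supp.mono {S T : Finset W} {j : ℕ} {z : Finset W → ZMod 2} (hz : Supp R S j z)
    (h : S ⊆ T) : Supp R T j z :=
  fun σ hσ => ⟨(hz σ hσ).1.trans h, (hz σ hσ).2⟩

theorem Supp.single {S σ : Finset W} (h : σ ⊆ S) (hR : (σ : Set W).Pairwise R) :
    Supp R S σ.card (Pi.single σ 1) := by
  intro τ hτ
  by_cases e : τ = σ
  · subst e
    exact ⟨h, rfl, hR⟩
  · simp [e] at hτ

/-- the complex is highly acyclic -/
theorem acyclic (hsymm : ∀ x y, R x y → R y x) (d : ℕ) (n : ℕ) :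
    ∀ (S F : Finset W) (k j : ℕ), S.card = n → F ⊆ S → (F : Set W).Pairwise R →
      d * k + 1 ≤ F.card → j ≤ k →
      (∀ e ∈ S, ∀ G ⊆ S, (G : Set W).Pairwise R → ∃ G' ⊆ G, (∀ g ∈ G', R e g) ∧
        G.card ≤ G'.card + d) →
      ∀ z, Supp R S j z → bd z = 0 → ∃ w, Supp R S (j + 1) w ∧ bd w = z := by
  classical
  induction n using Nat.strong_induction_on with
  | _ n ih =>
  intro S F k j hS hF hR hcard hjk hd z hz hbz
  obtain ⟨f, hf⟩ : F.Nonempty := Finset.card_pos.1 (by omega)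
  by_cases hbase : j = 0 ∨ S = F
  · refine ⟨cone f z, ?_, ?_⟩
    · intro σ hσ
      by_cases hfσ : f ∈ σ
      · simp only [cone, hfσ, if_true] at hσ
        obtain ⟨h1, h2, h3⟩ := hz _ hσ
        have hsub : σ ⊆ S := by
          intro x hx
          by_cases hxf : x = f
          · subst hxf; exact hF hf
          · exact h1 (Finset.mem_erase.2 ⟨hxf, hx⟩)
        refine ⟨hsub, ?_, ?_⟩
        · rw [← h2]
          exact (Finset.card_erase_add_one hfσ).symm
        · rcases hbase with h0 | h0
          · rw [h0, Finset.card_eq_zero] at h2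
            have : ∀ x ∈ σ, x = f := by
              intro x hx
              by_contra hne
              have : x ∈ σ.erase f := Finset.mem_erase.2 ⟨hne, hx⟩
              simp [h2] at this
            intro x hx y hy hxy
            exact absurd ((this x hx).trans (this y hy).symm) hxy
          · subst h0
            exact hR.mono (by exact_mod_cast hsub)
      · simp [cone, hfσ] at hσ
    · rw [bd_cone, hbz]
      funext σ
      simp [cone]
  · push Not at hbase
    obtain ⟨hj, hSF⟩ := hbase
    obtain ⟨e, heS, heF⟩ : ∃ e ∈ S, e ∉ F := by
      by_contra hcon
      push Not at hcon
      exact hSF (Finset.Subset.antisymm hcon hF)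
    obtain ⟨j, rfl⟩ : ∃ i, j = i + 1 := ⟨j - 1, by omega⟩
    obtain ⟨k, rfl⟩ : ∃ i, k = i + 1 := ⟨k - 1, by omega⟩
    have hlt : (S.erase e).card < n := by
      rw [← hS]; exact Finset.card_erase_lt_of_mem heS
    set S' := (S.erase e).filter (fun g => R e g) with hS'
    have hS'S : S' ⊆ S := (Finset.filter_subset _ _).trans (Finset.erase_subset _ _)
    have hlt' : S'.card < n := lt_of_le_of_lt (Finset.card_filter_le _ _) hlt
    obtain ⟨F', hF'F, hF'R, hF'c⟩ := hd e heS F hF hR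
    let u : Finset W → ZMod 2 := fun τ => if e ∈ τ then 0 else z (insert e τ)
    have hu : Supp R S' j u := by
      intro τ hτ
      by_cases heτ : e ∈ τ
      · simp [u, heτ] at hτ
      · simp only [u, heτ, if_false] at hτ
        obtain ⟨h1, h2, h3⟩ := hz _ hτ
        rw [Finset.card_insert_of_notMem heτ] at h2
        refine ⟨?_, by omega, h3.mono (by simp)⟩
        intro x hx
        have hxe : x ≠ e := by rintro rfl; exact heτ hx
        rw [hS', Finset.mem_filter, Finset.mem_erase]
        exact ⟨⟨hxe, h1 (by simp [hx])⟩, h3 (by simp) (by simp [hx]) hxe.symm⟩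
    have hbu : bd u = 0 := by
      funext τ
      simp only [bd, Pi.zero_apply]
      by_cases heτ : e ∈ τ
      · exact Finset.sum_eq_zero fun x _ => by simp [u, heτ]
      · have h0 := congrFun hbz (insert e τ)
        simp only [bd, Pi.zero_apply, Finset.compl_insert] at h0
        rw [← Finset.add_sum_erase _ _ (show e ∈ τᶜ by simpa using heτ)]
        rw [← h0]
        simp only [u, mem_insert, true_or, if_true, zero_add]
        refine Finset.sum_congr rfl fun x hx => ?_
        have hxe : e ≠ x := (Finset.ne_of_mem_erase hx).symm
        simp only [hxe, heτ, or_false, if_false]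
        rw [Finset.insert_comm]
    obtain ⟨v, hv, hbv⟩ := ih S'.card hlt' S' F' k j rfl
      (by
        intro x hx
        rw [hS', Finset.mem_filter, Finset.mem_erase]
        exact ⟨⟨by rintro rfl; exact heF (hF'F hx), hF (hF'F hx)⟩, hF'R x hx⟩)
      (hR.mono (by exact_mod_cast hF'F))
      (by rw [Nat.mul_succ] at hcard; omega) (by omega)
      (fun e' he' G hG => hd e' (hS'S he') G (hG.trans hS'S)) u hu hbu
    have heS' : e ∉ S' := by simp [hS']
    have hcv : Supp R S (j + 1 + 1) (cone e v) := by
      intro σ hσ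
      by_cases heσ : e ∈ σ
      · simp only [cone, heσ, if_true] at hσ
        obtain ⟨h1, h2, h3⟩ := hv _ hσ
        have hins : insert e (σ.erase e) = σ := Finset.insert_erase heσ
        refine ⟨?_, ?_, ?_⟩
        · rw [← hins]
          exact Finset.insert_subset heS (h1.trans hS'S)
        · rw [← h2]
          exact (Finset.card_erase_add_one heσ).symm
        · rw [← hins, Finset.coe_insert]
          refine h3.insert fun b hb _ => ?_
          have := (Finset.mem_filter.1 (h1 hb)).2
          exact ⟨this, hsymm _ _ this⟩
      · simp [cone, heσ] at hσ
    have hz' : Supp R (S.erase e) (j + 1) (z + bd (cone e v)) := by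
      intro σ hσ
      have hval : bd (cone e v) = v + cone e u := by rw [bd_cone, hbv]
      rw [hval] at hσ
      by_cases heσ : e ∈ σ
      · exfalso
        apply hσ
        have hvσ : v σ = 0 := by
          by_contra hne
          exact heS' ((hv σ hne).1 heσ)
        simp [hvσ, cone, heσ, u, Finset.insert_erase heσ, CharTwo.add_self_eq_zero]
      · have : z σ + v σ ≠ 0 := by simpa [cone, heσ] using hσ
        have hsum : Supp R S (j + 1) (z + v) := hz.add (hv.mono hS'S)
        obtain ⟨h1, h2⟩ := hsum σ this
        refine ⟨?_, h2⟩
        intro x hx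
        exact Finset.mem_erase.2 ⟨by rintro rfl; exact heσ hx, h1 hx⟩
    obtain ⟨w, hw, hbw⟩ := ih _ hlt (S.erase e) F (k + 1) (j + 1) rfl
      (fun x hx => Finset.mem_erase.2 ⟨by rintro rfl; exact heF hx, hF hx⟩) hR hcard hjk
      (fun e' he' G hG => hd e' (Finset.mem_of_mem_erase he') G
        (hG.trans (Finset.erase_subset _ _))) _ hz'
      (by rw [bd_add, hbz, bd_bd, add_zero])
    refine ⟨w + cone e v, (hw.mono (Finset.erase_subset _ _)).add hcv, ?_⟩
    rw [bd_add, hbw, add_assoc, two_zero, add_zero]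

section main

variable {V : Type*} [Fintype V] [DecidableEq V]

theorem exists_rep {A : Finset V} {E M : Finset (Finset V)}
    (hbip : ∀ e ∈ E, (e ∩ A).card = 1) (hM : HypMatching E M) (hc : M.card = A.card) :
    ∃ m : V → Finset V, (∀ a ∈ A, m a ∈ M ∧ m a ∩ A = {a}) ∧ M = A.image m := by
  have hinj : Set.InjOn (fun e => e ∩ A) (M : Set (Finset V)) := by
    intro e he f hf hef
    by_contra hne
    obtain ⟨a, ha⟩ := Finset.card_eq_one.1 (hbip e (hM.1 he))
    have h1 : a ∈ e ∩ A := by simp [ha]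
    have h2 : a ∈ f ∩ A := by
      have : e ∩ A = f ∩ A := hef
      rwa [← this]
    exact Finset.disjoint_left.1 (hM.2 e he f hf hne) (Finset.mem_inter.1 h1).1
      (Finset.mem_inter.1 h2).1
  have hsub : M.image (fun e => e ∩ A) ⊆ A.powersetCard 1 := by
    intro s hs
    obtain ⟨e, he, rfl⟩ := Finset.mem_image.1 hs
    exact Finset.mem_powersetCard.2 ⟨Finset.inter_subset_right, hbip e (hM.1 he)⟩
  have heq : M.image (fun e => e ∩ A) = A.powersetCard 1 :=
    Finset.eq_of_subset_of_card_le hsub (by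
      rw [Finset.card_image_of_injOn hinj, Finset.card_powersetCard, Nat.choose_one_right, hc])
  have hex : ∀ a ∈ A, ∃ e, e ∈ M ∧ e ∩ A = {a} := by
    intro a ha
    have : ({a} : Finset V) ∈ M.image (fun e => e ∩ A) := by
      rw [heq, Finset.mem_powersetCard]
      simp [ha]
    obtain ⟨e, he, h⟩ := Finset.mem_image.1 this
    exact ⟨e, he, h⟩
  choose! m hm using hex
  refine ⟨m, hm, ?_⟩
  symm
  refine Finset.eq_of_subset_of_card_le ?_ ?_
  · intro e he
    obtain ⟨a, ha, rfl⟩ := Finset.mem_image.1 he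
    exact (hm a ha).1
  · rw [Finset.card_image_of_injOn, hc]
    intro a ha b hb hab
    have := (hm a ha).2
    rw [hab, (hm b hb).2] at this
    exact (Finset.singleton_injective this).symm

/-- compatibility: disjoint on the `B`-side -/
def Comp (B : Finset V) (e f : Finset V) : Prop := Disjoint (e ∩ B) (f ∩ B)

theorem disj_of {A B e f : Finset V} (hcov : A ∪ B = Finset.univ)
    (hA : Disjoint (e ∩ A) (f ∩ A)) (hB : Disjoint (e ∩ B) (f ∩ B)) : Disjoint e f := by
  rw [Finset.disjoint_left] at *
  intro x hx hx'
  have : x ∈ A ∪ B := by simp [hcov]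
  rcases Finset.mem_union.1 this with h | h
  · exact hA (Finset.mem_inter.2 ⟨hx, h⟩) (Finset.mem_inter.2 ⟨hx', h⟩)
  · exact hB (Finset.mem_inter.2 ⟨hx, h⟩) (Finset.mem_inter.2 ⟨hx', h⟩)

theorem reach_match {B : Finset V} {E M σ : Finset (Finset V)} {k : ℕ}
    (hM : HypMatching E M) (hc : M.card = k)
    (h : Relation.ReflTransGen (BipMatAdj E B k) M σ) : HypMatching E σ ∧ σ.card = k := by
  cases h with
  | refl => exact ⟨hM, hc⟩
  | tail _ h => exact ⟨h.2.1, h.2.2.2.1⟩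

open Classical in
theorem facet_sum {A B : Finset V} (hcov : A ∪ B = Finset.univ)
    {E M τ : Finset (Finset V)} (hbip : ∀ e ∈ E, (e ∩ A).card = 1)
    (hM : HypMatching E M) (hc : M.card = A.card)
    (hτE : τ ⊆ E) (hτR : (τ : Set (Finset V)).Pairwise (Comp B)) :
    ∑ x ∈ τ, (if Relation.ReflTransGen (BipMatAdj E B A.card) M (τ.erase x) then (1 : ZMod 2)
      else 0) = 0 := by
  by_cases hex : ∃ x ∈ τ, Relation.ReflTransGen (BipMatAdj E B A.card) M (τ.erase x)
  swap
  · push Not at hex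
    exact Finset.sum_eq_zero fun x hx => by simp [hex x hx]
  obtain ⟨x, hx, hQ⟩ := hex
  obtain ⟨hσ, hσc⟩ := reach_match hM hc hQ
  obtain ⟨m, hm, hσm⟩ := exists_rep hbip hσ hσc
  obtain ⟨a, ha⟩ := Finset.card_eq_one.1 (hbip x (hτE hx))
  have hax : a ∈ x ∩ A := by simp [ha]
  obtain ⟨hax, haA⟩ := Finset.mem_inter.1 hax
  obtain ⟨hyσ, hyA⟩ := hm a haA
  set y := m a with hy
  obtain ⟨hyx, hyτ⟩ := Finset.mem_erase.1 hyσ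
  have hay : a ∈ y := by
    have : a ∈ y ∩ A := by simp [hyA]
    exact (Finset.mem_inter.1 this).1
  have hkey : ∀ f ∈ τ, f ≠ y → f ≠ x → Disjoint x f := by
    intro f hf hfy hfx
    refine disj_of hcov ?_ (hτR hx hf hfx.symm)
    rw [ha, Finset.disjoint_singleton_left]
    intro haf
    exact Finset.disjoint_left.1 (hσ.2 f (Finset.mem_erase.2 ⟨hfx, hf⟩) y hyσ hfy)
      (Finset.mem_inter.1 haf).1 hay
  have hmat : HypMatching E (τ.erase y) := by
    refine ⟨(Finset.erase_subset _ _).trans hτE, ?_⟩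
    intro e he f hf hef
    obtain ⟨hey, he⟩ := Finset.mem_erase.1 he
    obtain ⟨hfy, hf⟩ := Finset.mem_erase.1 hf
    by_cases hex : e = x
    · subst hex
      exact hkey f hf hfy hef.symm
    · by_cases hfx : f = x
      · subst hfx
        exact (hkey e he hey hef).symm
      · exact hσ.2 e (Finset.mem_erase.2 ⟨hex, he⟩) f (Finset.mem_erase.2 ⟨hfx, hf⟩) hef
  have hcy : (τ.erase y).card = A.card := by
    rw [← hσc, Finset.card_erase_of_mem hx, Finset.card_erase_of_mem hyτ]
  have hQy : Relation.ReflTransGen (BipMatAdj E B A.card) M (τ.erase y) := by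
    refine hQ.tail ⟨hσ, hmat, hσc, hcy, y, x, ?_, ?_, hτR hyτ hx hyx⟩
    · ext e
      simp only [mem_sdiff, mem_erase, mem_singleton]
      constructor
      · rintro ⟨⟨h1, h2⟩, h3⟩
        by_contra h
        exact h3 ⟨h, h2⟩
      · rintro rfl
        exact ⟨⟨hyx, hyτ⟩, fun h => h.1 rfl⟩
    · ext e
      simp only [mem_sdiff, mem_erase, mem_singleton]
      constructor
      · rintro ⟨⟨h1, h2⟩, h3⟩
        by_contra h
        exact h3 ⟨h, h2⟩
      · rintro rfl
        exact ⟨⟨hyx.symm, hx⟩, fun h => h.1 rfl⟩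
  rw [Finset.sum_eq_add_of_mem x y hx hyτ hyx.symm]
  · simp only [hQ, hQy, if_true]
    exact CharTwo.add_self_eq_zero _
  · rintro z hz ⟨hzx, hzy⟩
    rw [if_neg]
    intro hQz
    have hmz := (reach_match hM hc hQz).1
    exact Finset.disjoint_left.1 (hmz.2 x (Finset.mem_erase.2 ⟨hzx.symm, hx⟩) y
      (Finset.mem_erase.2 ⟨hzy.symm, hyτ⟩) hyx.symm) hax hay

theorem comp_bound {A B : Finset V} (hAB : Disjoint A B) (hcov : A ∪ B = Finset.univ)
    {E : Finset (Finset V)} {r : ℕ} (huniform : ∀ e ∈ E, e.card = r)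
    (hbip : ∀ e ∈ E, (e ∩ A).card = 1) (e : Finset V) (he : e ∈ E) (G : Finset (Finset V))
    (hG : (G : Set (Finset V)).Pairwise (Comp B)) :
    ∃ G' ⊆ G, (∀ g ∈ G', Comp B e g) ∧ G.card ≤ G'.card + (r - 1) := by
  classical
  refine ⟨G.filter (fun g => Comp B e g), Finset.filter_subset _ _,
    fun g hg => (Finset.mem_filter.1 hg).2, ?_⟩
  have hcard : (e ∩ B).card = r - 1 := by
    have h1 : e = (e ∩ A) ∪ (e ∩ B) := by
      rw [← Finset.inter_union_distrib_left, hcov, Finset.inter_univ]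
    have h2 : e.card = (e ∩ A).card + (e ∩ B).card := by
      conv_lhs => rw [h1]
      exact Finset.card_union_of_disjoint
        (hAB.mono Finset.inter_subset_right Finset.inter_subset_right)
    rw [huniform e he, hbip e he] at h2
    omega
  rw [← Finset.card_filter_add_card_filter_not (s := G) (fun g => Comp B e g), ← hcard]
  refine Nat.add_le_add_left ?_ _
  refine Finset.card_le_card_of_forall_subsingleton (fun g b => b ∈ g) ?_ ?_
  · intro g hg
    have := (Finset.mem_filter.1 hg).2
    simp only [Comp, Finset.not_disjoint_iff] at this
    obtain ⟨b, hb, hb'⟩ := this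
    exact ⟨b, hb, (Finset.mem_inter.1 hb').1⟩
  · intro b hb g hg g' hg'
    by_contra hne
    have hbB := (Finset.mem_inter.1 hb).2
    exact Finset.disjoint_left.1
      (hG (Finset.mem_filter.1 hg.1).1 (Finset.mem_filter.1 hg'.1).1 hne)
      (Finset.mem_inter.2 ⟨hg.2, hbB⟩) (Finset.mem_inter.2 ⟨hg'.2, hbB⟩)

theorem bd_image {X A : Finset V} (hX : X ⊆ A) (m : V → Finset V)
    (hm : ∀ a ∈ A, m a ∩ A = {a}) :
    bd (Pi.single (X.image m) 1) =
      ∑ x ∈ X, (Pi.single ((X.erase x).image m) 1 : Finset (Finset V) → ZMod 2) := by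
  have hinj : Set.InjOn m (X : Set V) := by
    intro a ha b hb hab
    have := hm a (hX ha)
    rw [hab, hm b (hX hb)] at this
    exact (Finset.singleton_injective this).symm
  rw [bd_single, Finset.sum_image hinj]
  refine Finset.sum_congr rfl fun x hx => ?_
  congr 1
  ext e
  simp only [mem_erase, mem_image]
  constructor
  · rintro ⟨h1, a, ha, rfl⟩
    exact ⟨a, ⟨by rintro rfl; exact h1 rfl, ha⟩, rfl⟩
  · rintro ⟨a, ⟨h1, ha⟩, rfl⟩
    exact ⟨fun h => h1 (hinj ha hx h), a, ha, rfl⟩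

theorem supp_image {X A B : Finset V} {E M : Finset (Finset V)} (hX : X ⊆ A)
    (hM : HypMatching E M) (m : V → Finset V) (hm : ∀ a ∈ A, m a ∈ M ∧ m a ∩ A = {a}) :
    Supp (Comp B) (E.filter fun e => e ∩ A ⊆ X) X.card (Pi.single (X.image m) 1) := by
  have hinj : Set.InjOn m (X : Set V) := by
    intro a ha b hb hab
    have := (hm a (hX ha)).2
    rw [hab, (hm b (hX hb)).2] at this
    exact (Finset.singleton_injective this).symm
  rw [← Finset.card_image_of_injOn hinj]
  apply Supp.single
  · intro e he
    obtain ⟨a, ha, rfl⟩ := Finset.mem_image.1 he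
    rw [Finset.mem_filter, (hm a (hX ha)).2]
    exact ⟨hM.1 (hm a (hX ha)).1, by simpa using ha⟩
  · intro e he f hf hef
    obtain ⟨a, ha, rfl⟩ := Finset.mem_image.1 he
    obtain ⟨b, hb, rfl⟩ := Finset.mem_image.1 hf
    exact (hM.2 _ (hm a (hX ha)).1 _ (hm b (hX hb)).1 hef).mono
      Finset.inter_subset_left Finset.inter_subset_left

/-- the family of homotopies -/
theorem exists_family (A B : Finset V) (hAB : Disjoint A B) (hcov : A ∪ B = Finset.univ)
    (E : Finset (Finset V)) (r : ℕ)
    (huniform : ∀ e ∈ E, e.card = r)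
    (hbip : ∀ e ∈ E, (e ∩ A).card = 1)
    (hlink : ∀ X ⊆ A, X.Nonempty →
      ∃ F ⊆ E, F.card = (r - 1) * X.card + 1 ∧
        (∀ e ∈ F, e ∩ A ⊆ X) ∧
        (∀ e ∈ F, ∀ f ∈ F, e ≠ f → Disjoint (e ∩ B) (f ∩ B)))
    (M M' : Finset (Finset V)) (hM : HypMatching E M) (hM' : HypMatching E M')
    (m m' : V → Finset V) (hm : ∀ a ∈ A, m a ∈ M ∧ m a ∩ A = {a})
    (hm' : ∀ a ∈ A, m' a ∈ M' ∧ m' a ∩ A = {a}) (n : ℕ) :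
    ∃ c : Finset V → Finset (Finset V) → ZMod 2, ∀ X ⊆ A, X.card ≤ n →
      Supp (Comp B) (E.filter fun e => e ∩ A ⊆ X) (X.card + 1) (c X) ∧
      bd (c X) = Pi.single (X.image m) 1 + Pi.single (X.image m') 1
        + ∑ x ∈ X, c (X.erase x) := by
  classical
  induction n with
  | zero =>
    refine ⟨fun _ => 0, fun X hX hc => ?_⟩
    have : X = ∅ := Finset.card_eq_zero.1 (by omega)
    subst this
    refine ⟨Supp.zero, ?_⟩
    simp [bd_zero, two_zero]
  | succ n ih =>
    obtain ⟨c, hc⟩ := ih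
    have hstep : ∀ X, X ⊆ A → X.card = n + 1 → ∃ w,
        Supp (Comp B) (E.filter fun e => e ∩ A ⊆ X) (X.card + 1) w ∧
        bd w = Pi.single (X.image m) 1 + Pi.single (X.image m') 1
          + ∑ x ∈ X, c (X.erase x) := by
      intro X hX hXc
      obtain ⟨F, hFE, hFc, hFX, hFR⟩ := hlink X hX (Finset.card_pos.1 (by omega))
      have hcx : ∀ x ∈ X, (X.erase x).card + 1 = X.card := fun x hx =>
        Finset.card_erase_add_one hx
      have hcc : ∀ x ∈ X, _ := fun x hx => hc (X.erase x) ((Finset.erase_subset _ _).trans hX)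
        (by have := hcx x hx; omega)
      refine acyclic (R := Comp B) (fun x y h => h.symm) (r - 1) _ _ F X.card X.card rfl ?_ ?_
        hFc.ge le_rfl ?_ _ ?_ ?_
      · intro e he
        exact Finset.mem_filter.2 ⟨hFE he, hFX e he⟩
      · intro e he f hf hef
        exact hFR e he f hf hef
      · intro e he G _ hG
        exact comp_bound hAB hcov huniform hbip e (Finset.mem_filter.1 he).1 G hG
      · refine ((supp_image hX hM m hm).add (supp_image hX hM' m' hm')).add
          (Supp.sum _ _ fun x hx => ?_)
        have := (hcc x hx).1
        rw [hcx x hx] at this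
        refine this.mono ?_
        intro e he
        rw [Finset.mem_filter] at he ⊢
        exact ⟨he.1, he.2.trans (Finset.erase_subset _ _)⟩
      · rw [bd_add, bd_add, bd_sum, bd_image hX m (fun a ha => (hm a ha).2),
          bd_image hX m' (fun a ha => (hm' a ha).2),
          Finset.sum_congr rfl (fun x hx => (hcc x hx).2), Finset.sum_add_distrib,
          Finset.sum_add_distrib, ← add_assoc, two_zero, zero_add]
        exact symm_sum two_zero X (fun x y => c ((X.erase x).erase y))
          (fun x y => by rw [Finset.erase_right_comm])
    choose! w hw using hstep
    refine ⟨fun X => if X.card = n + 1 then w X else c X, fun X hX hXn => ?_⟩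
    have hsum : ∑ x ∈ X, (if (X.erase x).card = n + 1 then w (X.erase x) else c (X.erase x))
        = ∑ x ∈ X, c (X.erase x) := by
      refine Finset.sum_congr rfl fun x hx => ?_
      have := Finset.card_erase_add_one hx
      rw [if_neg (by omega)]
    simp only [hsum]
    by_cases h : X.card = n + 1
    · rw [if_pos h]
      exact hw X hX h
    · rw [if_neg h]
      exact hc X hX (by omega)

end main

end RGProof

/-- Reconfiguration version of the Aharoni–Haxell theorem: if `H` is a bipartite
`r`-uniform hypergraph with bipartition `(A, B)` and `ν(lk_H(X)) ≥ (r−1)|X| + 1` for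
every nonempty `X ⊆ A`, then the reconfiguration graph on matchings of size `|A|` is
connected. -/
theorem stmt_11 {V : Type*} [Fintype V] [DecidableEq V]
    (A B : Finset V) (hAB : Disjoint A B) (hABcover : A ∪ B = Finset.univ)
    (E : Finset (Finset V)) (r : ℕ)
    (huniform : ∀ e ∈ E, e.card = r)
    (hbip : ∀ e ∈ E, (e ∩ A).card = 1)
    (hlink : ∀ X ⊆ A, X.Nonempty →
      ∃ F ⊆ E, F.card = (r - 1) * X.card + 1 ∧
        (∀ e ∈ F, e ∩ A ⊆ X) ∧
        (∀ e ∈ F, ∀ f ∈ F, e ≠ f → Disjoint (e ∩ B) (f ∩ B)))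
    (M M' : Finset (Finset V))
    (hM : HypMatching E M) (hMcard : M.card = A.card)
    (hM' : HypMatching E M') (hM'card : M'.card = A.card) :
    Relation.ReflTransGen (BipMatAdj E B A.card) M M' := by
  classical
  obtain ⟨m, hm, hMm⟩ := RGProof.exists_rep hbip hM hMcard
  obtain ⟨m', hm', hMm'⟩ := RGProof.exists_rep hbip hM' hM'card
  obtain ⟨c, hc⟩ := RGProof.exists_family A B hAB hABcover E r huniform hbip hlink M M' hM hM'
    m m' hm hm' A.card
  obtain ⟨hS, hb⟩ := hc A subset_rfl le_rfl
  rw [← hMm, ← hMm'] at hb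
  let ψ : Finset (Finset V) → ZMod 2 := fun σ =>
    if Relation.ReflTransGen (BipMatAdj E B A.card) M σ then 1 else 0
  have hadj := RGProof.bd_adj ψ (c A)
  have hz : ∑ τ, (∑ x ∈ τ, ψ (τ.erase x)) * c A τ = 0 := by
    refine Finset.sum_eq_zero fun τ _ => ?_
    by_cases h : c A τ = 0
    · rw [h, mul_zero]
    · obtain ⟨h1, _, h3⟩ := hS τ h
      rw [RGProof.facet_sum hABcover hbip hM hMcard (h1.trans (Finset.filter_subset _ _)) h3,
        zero_mul]
  have hzero : ∀ a ∈ A, ∀ σ, ψ σ * c (A.erase a) σ = 0 := by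
    intro a ha σ
    by_contra hne
    have h1 : ψ σ ≠ 0 := left_ne_zero_of_mul hne
    have h2 : c (A.erase a) σ ≠ 0 := right_ne_zero_of_mul hne
    have hQ : Relation.ReflTransGen (BipMatAdj E B A.card) M σ := by
      by_contra h
      exact h1 (if_neg h)
    obtain ⟨hσ, hσc⟩ := RGProof.reach_match hM hMcard hQ
    obtain ⟨p, hp, _⟩ := RGProof.exists_rep hbip hσ hσc
    have h3 := ((hc (A.erase a) (Finset.erase_subset _ _)
      (Finset.card_le_card (Finset.erase_subset _ _))).1 σ h2).1 (hp a ha).1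
    have h4 := (Finset.mem_filter.1 h3).2
    rw [(hp a ha).2] at h4
    simp at h4
  rw [hz, hb] at hadj
  simp only [Pi.add_apply, mul_add, Finset.sum_add_distrib, Finset.sum_apply, Finset.mul_sum]
    at hadj
  have h0 : ∑ σ, ∑ a ∈ A, ψ σ * c (A.erase a) σ = 0 :=
    Finset.sum_eq_zero fun σ _ => Finset.sum_eq_zero fun a ha => hzero a ha σ
  have hsingle : ∀ N : Finset (Finset V), ∑ σ, ψ σ * (Pi.single N 1 : _ → ZMod 2) σ = ψ N := by
    intro N
    rw [Finset.sum_eq_single N]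
    · simp
    · intro b _ hbN
      simp [hbN]
    · simp
  rw [h0, hsingle, hsingle, add_zero] at hadj
  by_contra hcon
  have e1 : ψ M = 1 := if_pos Relation.ReflTransGen.refl
  have e2 : ψ M' = 0 := if_neg hcon
  rw [e1, e2] at hadj
  simp at hadj
end
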